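/- There exist constants c > 0, c' > 0 and d₀ such that for all integers d ≥ d₀: |{f ∈ F : |R(f)| > 5}| ≤ e^{−cd}·|F| and |{f ∈ F : |R(f)| = 5}| ≥ c'·|F|. (Equivalently, a uniformly random element of F takes more than five values with probability e^{−Ω(d)}, and takes exactly five values with probability Ω(1).) -/

import Mathlib

/-- Two vertices of the Hamming cube `{0,1}^d` are adjacent iff they differ in
exactly one coordinate. -/
def cubeAdj (d : ℕ) (u v : Fin d → Bool) : Prop :=
  (Finset.univ.filter fun i => u i ≠ v i).card = 1


/-- The set of homomorphisms from `Q_d` to `ℤ` sending the all-zeros vertex to `0`. -/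
def HomF (d : ℕ) : Set ((Fin d → Bool) → ℤ) :=
  {f | f (fun _ => false) = 0 ∧ ∀ u v, cubeAdj d u v → |f u - f v| = 1}

namespace CubeHom

open Finset
open scoped Classical
set_option linter.unusedSectionVars false

section

variable {V : Type*} [Fintype V] [DecidableEq V]

/-- `K` contains `v` and is connected with respect to `r`, phrased by cuts. -/
def LinkedFrom {V : Type*} [DecidableEq V] (r : V → V → Prop) (v : V) (K : Finset V) : Prop :=
  v ∈ K ∧ ∀ L ⊆ K, v ∈ L → L ≠ K → ∃ x ∈ L, ∃ y ∈ K \ L, r x y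

theorem exists_component {V : Type*} [DecidableEq V] (r : V → V → Prop) {v : V} {A : Finset V} (hv : v ∈ A) :
    ∃ K ⊆ A, LinkedFrom r v K ∧ ∀ x ∈ K, ∀ y ∈ A \ K, ¬ r x y := by
  obtain ⟨K, hK, hmin⟩ := exists_min_image
    (A.powerset.filter fun K => v ∈ K ∧ ∀ x ∈ K, ∀ y ∈ A \ K, ¬ r x y) card
    ⟨A, by simp [hv]; tauto⟩
  simp only [mem_filter, mem_powerset] at hK hmin
  obtain ⟨hKA, hvK, hsep⟩ := hK
  refine ⟨K, hKA, ⟨hvK, fun L hLK hvL hne => ?_⟩, hsep⟩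
  by_contra! hcon
  have hlt : L.card < K.card := card_lt_card (hLK.ssubset_of_ne hne)
  refine absurd (hmin L ⟨hLK.trans hKA, hvL, fun x hx y hy => ?_⟩) (not_le.2 hlt)
  simp only [mem_sdiff] at hy
  by_cases hyK : y ∈ K
  · exact hcon x hx y (by simp [hyK, hy.2])
  · exact hsep x (hLK hx) y (by simp [hyK, hy.1])

theorem LinkedFrom.subset_of_separated {V : Type*} [DecidableEq V] {r : V → V → Prop} {v : V} {K L T : Finset V}
    (hK : LinkedFrom r v K) (hKT : K ⊆ T) (hv : v ∈ L)
    (hL : ∀ x ∈ L, ∀ y, r x y → y ∉ L → y ∉ T) : K ⊆ L := by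
  by_contra hcon
  obtain ⟨x, hx, y, hy, hr⟩ := hK.2 (K ∩ L) inter_subset_left (by simp [hK.1, hv])
    (fun h => hcon (by rw [← h]; exact inter_subset_right))
  simp only [mem_inter, mem_sdiff, not_and] at hx hy
  exact hL x hx.2 y hr (hy.2 hy.1) (hKT hy.1)

theorem sum_bernoulli_eq_one {V : Type*} (R : Finset V) (p : ℝ) :
    ∑ T ∈ R.powerset, p ^ T.card * (1 - p) ^ (R.card - T.card) = 1 := by
  rw [Finset.sum_pow_mul_eq_add_pow]; simp

theorem card_linkedFrom_le {V : Type*} [Fintype V] [DecidableEq V] (r : V → V → Prop) {D : ℕ} (hD0 : 0 < D)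
    (hD : ∀ x, (univ.filter (r x)).card ≤ D) (v : V) (s : ℕ) :
    ((univ.filter fun K => LinkedFrom r v K ∧ K.card ≤ s).card : ℝ) ≤ (3 * (D + 1)) ^ s := by
  set p : ℝ := 1 / (D + 1) with hp
  have hDpos : (0 : ℝ) < D := by exact_mod_cast hD0
  have hp0 : 0 < p := by positivity
  have hp1 : 0 < 1 - p := by
    rw [hp, sub_pos, div_lt_one (by positivity)]; linarith
  set bd : Finset V → Finset V := fun K => (K.biUnion fun x => univ.filter (r x)) \ K with hbd
  set fam : Finset V → Finset (Finset V) := fun K =>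
    ((univ \ (K ∪ bd K)).powerset).image fun T => K ∪ T with hfam
  set W : Finset V → ℝ := fun T => p ^ T.card * (1 - p) ^ (Fintype.card V - T.card) with hW
  have hdisjKb : ∀ K, Disjoint K (bd K) := fun K => disjoint_sdiff
  have hWsum : ∀ K, ∑ T ∈ fam K, W T = p ^ K.card * (1 - p) ^ (bd K).card := by
    intro K
    set R := univ \ (K ∪ bd K) with hR
    have hKR : Disjoint K R := by
      rw [hR]; exact disjoint_of_subset_left subset_union_left disjoint_sdiff
    have hcard : Fintype.card V = K.card + (bd K).card + R.card := by
      rw [← card_union_of_disjoint (hdisjKb K), hR, card_sdiff_of_subset (subset_univ _), card_univ]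
      have := card_le_univ (K ∪ bd K)
      omega
    rw [hfam, sum_image]
    · refine Eq.trans ?_ (mul_one (p ^ K.card * (1 - p) ^ (bd K).card))
      refine Eq.trans ?_ (congrArg _ (sum_bernoulli_eq_one R p))
      rw [mul_sum]
      refine sum_congr rfl fun T hT => ?_
      rw [mem_powerset] at hT
      have h1 := card_le_card hT
      rw [hW]
      simp only
      rw [card_union_of_disjoint (disjoint_of_subset_right hT hKR), hcard,
        show K.card + (bd K).card + R.card - (K.card + T.card) =
          (bd K).card + (R.card - T.card) by omega, pow_add, pow_add]
      ring
    · intro T hT T' hT' h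
      simp only [coe_powerset, Set.mem_preimage, Set.mem_powerset_iff, coe_subset] at hT hT'
      have e : ∀ T ⊆ R, (K ∪ T) \ K = T := fun T hT =>
        union_sdiff_cancel_left (disjoint_of_subset_right hT hKR)
      simp only at h
      rw [← e T hT, h, e T' hT']
  have hsep : ∀ K, ∀ T ∈ fam K, K ⊆ T ∧ ∀ x ∈ K, ∀ y, r x y → y ∉ K → y ∉ T := by
    intro K T hT
    simp only [hfam, mem_image, mem_powerset] at hT
    obtain ⟨T', hT', rfl⟩ := hT
    refine ⟨subset_union_left, fun x hx y hr hy hyT => ?_⟩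
    rcases mem_union.1 hyT with h | h
    · exact hy h
    · have h2 := hT' h
      simp only [mem_sdiff, mem_univ, true_and, mem_union, not_or, hbd, mem_biUnion,
        mem_filter, not_and, not_not] at h2
      exact h2.1 (h2.2 ⟨x, hx, hr⟩)
  set 𝒦 := univ.filter fun K => LinkedFrom r v K ∧ K.card ≤ s with h𝒦
  have hdis : ∀ K ∈ 𝒦, ∀ L ∈ 𝒦, K ≠ L → Disjoint (fam K) (fam L) := by
    intro K hK L hL hne
    rw [Finset.disjoint_left]
    intro T hT hT'
    simp only [h𝒦, mem_filter, mem_univ, true_and] at hK hL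
    obtain ⟨a1, a2⟩ := hsep K T hT
    obtain ⟨b1, b2⟩ := hsep L T hT'
    exact hne ((hK.1.subset_of_separated a1 hL.1.1 b2).antisymm
      (hL.1.subset_of_separated b1 hK.1.1 a2))
  have hone : ∑ K ∈ 𝒦, p ^ K.card * (1 - p) ^ (bd K).card ≤ 1 := by
    calc ∑ K ∈ 𝒦, p ^ K.card * (1 - p) ^ (bd K).card = ∑ K ∈ 𝒦, ∑ T ∈ fam K, W T :=
          sum_congr rfl fun K _ => (hWsum K).symm
      _ = ∑ T ∈ 𝒦.biUnion fam, W T := (sum_biUnion hdis).symm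
      _ ≤ ∑ T ∈ (univ : Finset V).powerset, W T :=
          sum_le_sum_of_subset_of_nonneg (by intro T _; simp) fun T _ _ => by
            simp only [hW]; positivity
      _ = 1 := by simpa [hW] using sum_bernoulli_eq_one (univ : Finset V) p
  have hthird : 1 / (3 * (D + 1) : ℝ) ≤ p * (1 - p) ^ D := by
    have h1 : (1 - p) * (1 + 1 / D) = 1 := by rw [hp]; field_simp; ring
    have h2 : (1 + 1 / (D : ℝ)) ^ D ≤ 3 := by
      calc (1 + 1 / (D : ℝ)) ^ D ≤ (Real.exp (1 / D)) ^ D := by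
            gcongr; linarith [Real.add_one_le_exp (1 / (D : ℝ))]
        _ = Real.exp 1 := by rw [← Real.exp_nat_mul]; congr 1; field_simp
        _ ≤ 3 := by linarith [Real.exp_one_lt_d9]
    have h3 : (1 - p) ^ D * (1 + 1 / (D : ℝ)) ^ D = 1 := by rw [← mul_pow, h1, one_pow]
    have h4 : 1 / 3 ≤ (1 - p) ^ D := by
      have : 0 < (1 - p) ^ D := by positivity
      nlinarith
    calc 1 / (3 * (D + 1) : ℝ) = p * (1 / 3) := by rw [hp]; field_simp
      _ ≤ _ := by gcongr
  have hterm : ∀ K ∈ 𝒦, (1 / (3 * (D + 1) : ℝ)) ^ s ≤ p ^ K.card * (1 - p) ^ (bd K).card := by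
    intro K hK
    simp only [h𝒦, mem_filter, mem_univ, true_and] at hK
    have hb : (bd K).card ≤ D * K.card := by
      calc (bd K).card ≤ (K.biUnion fun x => univ.filter (r x)).card := card_le_card sdiff_subset
        _ ≤ ∑ x ∈ K, (univ.filter (r x)).card := card_biUnion_le
        _ ≤ ∑ _x ∈ K, D := sum_le_sum fun x _ => hD x
        _ = D * K.card := by simp [mul_comm]
    calc (1 / (3 * (D + 1) : ℝ)) ^ s ≤ (1 / (3 * (D + 1) : ℝ)) ^ K.card :=
          pow_le_pow_of_le_one (by positivity) (by
            rw [div_le_one (by positivity)]; linarith) hK.2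
      _ ≤ (p * (1 - p) ^ D) ^ K.card := by gcongr
      _ = p ^ K.card * (1 - p) ^ (D * K.card) := by rw [mul_pow, pow_mul]
      _ ≤ _ := by
          gcongr 1
          exact pow_le_pow_of_le_one hp1.le (by linarith) hb
  have hfin := (sum_le_sum hterm).trans hone
  rw [sum_const, nsmul_eq_mul, div_pow, one_pow, mul_one_div, div_le_one (by positivity)] at hfin
  exact hfin

theorem card_powerset_filter_le {α : Type*} [DecidableEq α] (M : Finset α) {R : ℝ} (hR : 1 ≤ R) (s : ℕ)
    (hM : (M.card : ℝ) ≤ R * s) :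
    ((M.powerset.filter fun T => T.card ≤ s).card : ℝ) ≤ (3 * R) ^ s := by
  have hR0 : 0 < R := by linarith
  have h1 : ∑ T ∈ M.powerset, (1 / R) ^ T.card * (1 : ℝ) ^ (M.card - T.card)
      = (1 / R + 1) ^ M.card := Finset.sum_pow_mul_eq_add_pow _ _ _
  have h2 : ∑ T ∈ M.powerset.filter (fun T => T.card ≤ s), (1 / R) ^ s
      ≤ ∑ T ∈ M.powerset, (1 / R) ^ T.card * (1 : ℝ) ^ (M.card - T.card) := by
    refine (sum_le_sum fun T hT => ?_).trans
      (sum_le_sum_of_subset_of_nonneg (filter_subset _ _) fun T _ _ => by positivity)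
    rw [one_pow, mul_one]
    exact pow_le_pow_of_le_one (by positivity) (by rw [div_le_one hR0]; exact hR)
      (mem_filter.1 hT).2
  have h3 : (1 / R + 1) ^ M.card ≤ (3 : ℝ) ^ s := by
    calc (1 / R + 1) ^ M.card ≤ (Real.exp (1 / R)) ^ M.card := by
          gcongr; exact Real.add_one_le_exp _
      _ = Real.exp (M.card / R) := by rw [← Real.exp_nat_mul]; congr 1; field_simp
      _ ≤ Real.exp s := by
          gcongr; rw [div_le_iff₀ hR0]; linarith
      _ = (Real.exp 1) ^ s := by rw [← Real.exp_nat_mul]; simp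
      _ ≤ 3 ^ s := by gcongr; linarith [Real.exp_one_lt_d9]
  rw [sum_const, nsmul_eq_mul, h1, div_pow, one_pow, mul_one_div, div_le_iff₀ (by positivity)] at h2
  calc _ ≤ (1 / R + 1) ^ M.card * R ^ s := h2
    _ ≤ 3 ^ s * R ^ s := by gcongr
    _ = _ := by rw [mul_pow]

/-- The union of the neighbourhoods of the points of `A`. -/
def nbhd {V : Type*} [DecidableEq V] (nb : V → Finset V) (A : Finset V) : Finset V :=
  A.biUnion nb

/-- The points whose whole neighbourhood lies in `A`. -/
def core (nb : V → Finset V) (A : Finset V) : Finset V :=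
  univ.filter fun x => nb x ⊆ A

/-- The closure of `A` contains at most half of the points. -/
def Small (nb : V → Finset V) (A : Finset V) : Prop :=
  2 * (core nb (nbhd nb A)).card ≤ Fintype.card V

/-- Two points are near if their neighbourhoods meet. -/
def Near {V : Type*} (nb : V → Finset V) (x y : V) : Prop :=
  ¬ Disjoint (nb x) (nb y)

/-- The number of chains `A = A₀, A₁, …, Aₘ = ∅` in which each `Aᵢ` contains the
neighbourhood of `Aᵢ₊₁`. -/
def Phi (nb : V → Finset V) : ℕ → Finset V → ℕ
  | 0, A => if A = ∅ then 1 else 0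
  | m + 1, A => ∑ B ∈ univ.filter (fun B => nbhd nb B ⊆ A), Phi nb m B

/-- The weight of `A` as a set of exceptional points. -/
noncomputable def wt (nb : V → Finset V) (m : ℕ) (A : Finset V) : ℝ :=
  Phi nb m A / 2 ^ (nbhd nb A).card

/-- `nb` is the system of neighbourhoods of a reflexive symmetric `d`-regular relation. -/
structure IsReg (nb : V → Finset V) (d : ℕ) : Prop where
  refl : ∀ x, x ∈ nb x
  symm : ∀ x y, y ∈ nb x → x ∈ nb y
  card : ∀ x, (nb x).card = d

theorem mem_nbhd {V : Type*} [DecidableEq V] {nb : V → Finset V} {A : Finset V} {y : V} :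
    y ∈ nbhd nb A ↔ ∃ x ∈ A, y ∈ nb x := by
  simp [nbhd]

theorem mem_core {nb : V → Finset V} {A : Finset V} {x : V} : x ∈ core nb A ↔ nb x ⊆ A := by
  simp [core]

theorem nbhd_mono {V : Type*} [DecidableEq V] (nb : V → Finset V) {A B : Finset V} (h : A ⊆ B) :
    nbhd nb A ⊆ nbhd nb B :=
  biUnion_subset_biUnion_of_subset_left _ h

theorem nbhd_union {V : Type*} [DecidableEq V] (nb : V → Finset V) (A B : Finset V) :
    nbhd nb (A ∪ B) = nbhd nb A ∪ nbhd nb B := by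
  ext; simp only [mem_nbhd, mem_union]; grind

theorem core_mono (nb : V → Finset V) {A B : Finset V} (h : A ⊆ B) : core nb A ⊆ core nb B := by
  intro x hx
  rw [mem_core] at *
  exact hx.trans h

theorem subset_core_nbhd (nb : V → Finset V) (A : Finset V) : A ⊆ core nb (nbhd nb A) := by
  intro x hx
  rw [mem_core]
  exact subset_biUnion_of_mem nb hx

theorem Small.mono {nb : V → Finset V} {A B : Finset V} (hB : Small nb B) (h : A ⊆ B) :
    Small nb A := by
  have := card_le_card (core_mono nb (nbhd_mono nb h))
  unfold Small at *
  omega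

namespace IsReg

variable {nb : V → Finset V} {d : ℕ}

theorem subset_nbhd (h : IsReg nb d) (A : Finset V) : A ⊆ nbhd nb A := fun x hx =>
  mem_nbhd.2 ⟨x, hx, h.refl x⟩

theorem core_subset (h : IsReg nb d) (A : Finset V) : core nb A ⊆ A := fun x hx =>
  mem_core.1 hx (h.refl x)

theorem nbhd_core_subset (_h : IsReg nb d) (A : Finset V) : nbhd nb (core nb A) ⊆ A := by
  intro y hy
  obtain ⟨x, hx, hy⟩ := mem_nbhd.1 hy
  exact mem_core.1 hx hy

theorem nbhd_core_nbhd (h : IsReg nb d) (A : Finset V) :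
    nbhd nb (core nb (nbhd nb A)) = nbhd nb A :=
  (h.nbhd_core_subset _).antisymm (nbhd_mono nb (subset_core_nbhd nb A))

theorem nbhd_eq_empty (h : IsReg nb d) {A : Finset V} (hA : nbhd nb A ⊆ ∅) : A = ∅ :=
  subset_empty.1 ((h.subset_nbhd A).trans hA)

theorem small_of_nbhd_subset (h : IsReg nb d) {A B : Finset V} (hA : Small nb A)
    (hB : nbhd nb B ⊆ A) : Small nb B := by
  have := card_le_card
    ((core_mono nb hB).trans ((h.core_subset A).trans (subset_core_nbhd nb A)))
  unfold Small at *
  omega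

theorem Phi_empty (h : IsReg nb d) (m : ℕ) : Phi nb m ∅ = 1 := by
  induction m with
  | zero => simp [Phi]
  | succ m ih =>
    have : (univ.filter fun B => nbhd nb B ⊆ ∅) = {∅} := by
      ext B
      simp only [mem_filter, mem_univ, true_and, mem_singleton]
      exact ⟨h.nbhd_eq_empty, by rintro rfl; simp [nbhd]⟩
    rw [Phi, this, sum_singleton, ih]

theorem Phi_union_le (h : IsReg nb d) (m : ℕ) : ∀ A B : Finset V,
    Disjoint (nbhd nb A) (nbhd nb B) → Phi nb m (A ∪ B) ≤ Phi nb m A * Phi nb m B := by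
  induction m with
  | zero =>
    intro A B _
    simp only [Phi, union_eq_empty]
    split_ifs <;> simp_all
  | succ m ih =>
    intro A B hAB
    have hABd : Disjoint A B :=
      disjoint_of_subset_left (h.subset_nbhd A) (disjoint_of_subset_right (h.subset_nbhd B) hAB)
    have key : ∀ C, nbhd nb C ⊆ A ∪ B → C = (C ∩ core nb A) ∪ (C ∩ core nb B) := by
      intro C hC
      refine Subset.antisymm (fun y hy => ?_) (union_subset inter_subset_left inter_subset_left)
      have hny : nb y ⊆ A ∪ B := (subset_biUnion_of_mem nb hy).trans hC
      simp only [mem_union, mem_inter, hy, true_and, mem_core]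
      by_contra! hcon
      obtain ⟨a, ha, haA⟩ := not_subset.1 hcon.1
      obtain ⟨b, hb, hbB⟩ := not_subset.1 hcon.2
      have haB : a ∈ B := (mem_union.1 (hny ha)).resolve_left haA
      have hbA : b ∈ A := (mem_union.1 (hny hb)).resolve_right hbB
      exact (Finset.disjoint_left.1 hAB) (mem_nbhd.2 ⟨b, hbA, h.symm _ _ hb⟩)
        (mem_nbhd.2 ⟨a, haB, h.symm _ _ ha⟩)
    have hsub : ∀ C D : Finset V, nbhd nb (C ∩ core nb D) ⊆ D := fun C D =>
      (nbhd_mono nb inter_subset_right).trans (h.nbhd_core_subset D)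
    simp only [Phi]
    rw [sum_mul_sum, ← sum_product']
    calc ∑ C ∈ univ.filter (fun C => nbhd nb C ⊆ A ∪ B), Phi nb m C
        ≤ ∑ C ∈ univ.filter (fun C => nbhd nb C ⊆ A ∪ B),
            Phi nb m (C ∩ core nb A) * Phi nb m (C ∩ core nb B) := by
          refine sum_le_sum fun C hC => ?_
          conv_lhs => rw [key C (mem_filter.1 hC).2]
          exact ih _ _ (disjoint_of_subset_left (hsub _ _)
            (disjoint_of_subset_right (hsub _ _) hABd))
      _ = ∑ p ∈ (univ.filter fun C => nbhd nb C ⊆ A ∪ B).image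
            (fun C => (C ∩ core nb A, C ∩ core nb B)), Phi nb m p.1 * Phi nb m p.2 := by
          rw [sum_image]
          intro C hC D hD hCD
          simp only [coe_filter, mem_univ, true_and, Set.mem_ofPred_eq, Prod.mk.injEq] at hC hD hCD
          rw [key C hC, key D hD, hCD.1, hCD.2]
      _ ≤ _ := by
          refine sum_le_sum_of_subset ?_
          intro p hp
          obtain ⟨C, -, rfl⟩ := mem_image.1 hp
          simp [hsub]

theorem wt_nonneg (m : ℕ) (A : Finset V) : 0 ≤ wt nb m A := by
  unfold wt; positivity

theorem wt_union_le (h : IsReg nb d) (m : ℕ) {A B : Finset V}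
    (hAB : Disjoint (nbhd nb A) (nbhd nb B)) : wt nb m (A ∪ B) ≤ wt nb m A * wt nb m B := by
  unfold wt
  rw [nbhd_union, card_union_of_disjoint hAB, pow_add, div_mul_div_comm]
  gcongr
  exact_mod_cast h.Phi_union_le m A B hAB

/-- Splitting off the component of `v`. -/
theorem sum_component_le (h : IsReg nb d) (m : ℕ) (v : V) (P : Finset V → Prop)
    (Λ : Finset V) (𝒜 : Finset (Finset V)) (hs : ∀ A ∈ 𝒜, Small nb A ∧ A \ {v} ⊆ Λ)
    (hK : ∀ A ∈ 𝒜, ∃ K ⊆ A, LinkedFrom (Near nb) v K ∧ P K ∧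
      ∀ x ∈ K, ∀ y ∈ A \ K, ¬ Near nb x y) :
    ∑ A ∈ 𝒜, wt nb m A ≤
      (∑ K ∈ univ.filter (fun K => LinkedFrom (Near nb) v K ∧ Small nb K ∧ P K), wt nb m K) *
        ∑ B ∈ Λ.powerset.filter (Small nb), wt nb m B := by
  choose! K hKA hKl hKP hKs using hK
  rw [sum_mul_sum, ← sum_product']
  have hun : ∀ A ∈ 𝒜, K A ∪ A \ K A = A := fun A hA => union_sdiff_of_subset (hKA A hA)
  calc ∑ A ∈ 𝒜, wt nb m A ≤ ∑ A ∈ 𝒜, wt nb m (K A) * wt nb m (A \ K A) := by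
        refine sum_le_sum fun A hA => ?_
        conv_lhs => rw [← hun A hA]
        apply h.wt_union_le
        rw [Finset.disjoint_left]
        intro z hz hz'
        obtain ⟨x, hx, hzx⟩ := mem_nbhd.1 hz
        obtain ⟨y, hy, hzy⟩ := mem_nbhd.1 hz'
        exact hKs A hA x hx y hy fun hd => (Finset.disjoint_left.1 hd) hzx hzy
    _ = ∑ p ∈ 𝒜.image (fun A => (K A, A \ K A)), wt nb m p.1 * wt nb m p.2 := by
        rw [sum_image]
        intro A hA B hB hAB
        simp only [Prod.mk.injEq] at hAB
        rw [← hun A hA, ← hun B hB, hAB.2, hAB.1]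
    _ ≤ _ := by
        refine sum_le_sum_of_subset_of_nonneg ?_ fun p _ _ =>
          mul_nonneg (wt_nonneg _ _) (wt_nonneg _ _)
        intro p hp
        obtain ⟨A, hA, rfl⟩ := mem_image.1 hp
        simp only [mem_product, mem_filter, mem_univ, true_and, mem_powerset]
        refine ⟨⟨hKl A hA, (hs A hA).1.mono (hKA A hA), hKP A hA⟩, ?_,
          (hs A hA).1.mono sdiff_subset⟩
        refine (sdiff_subset_sdiff subset_rfl ?_).trans (hs A hA).2
        simpa using (hKl A hA).1

theorem sum_wt_le (h : IsReg nb d) (m : ℕ) {ε : ℝ} (hε0 : 0 ≤ ε)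
    (hε : ∀ v, ∑ K ∈ univ.filter (fun K => LinkedFrom (Near nb) v K ∧ Small nb K), wt nb m K ≤ ε)
    (Λ : Finset V) : ∑ A ∈ Λ.powerset.filter (Small nb), wt nb m A ≤ (1 + ε) ^ Λ.card := by
  induction Λ using Finset.induction_on with
  | empty =>
    simp only [powerset_empty, card_empty, pow_zero]
    refine (sum_le_sum_of_subset_of_nonneg (filter_subset _ _)
      fun _ _ _ => wt_nonneg _ _).trans ?_
    simp [wt, h.Phi_empty, nbhd]
  | insert v Λ hv ih =>
    rw [card_insert_of_notMem hv, pow_succ]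
    rw [← sum_filter_add_sum_filter_not _ (fun A => v ∈ A)]
    have h1 := h.sum_component_le m v (fun _ => True) Λ
      (((insert v Λ).powerset.filter (Small nb)).filter fun A => v ∈ A) (by
        intro A hA
        simp only [mem_filter, mem_powerset] at hA
        refine ⟨hA.1.2, ?_⟩
        intro x hx
        simp only [mem_sdiff, mem_singleton] at hx
        exact (mem_insert.1 (hA.1.1 hx.1)).resolve_left hx.2) (by
        intro A hA
        simp only [mem_filter] at hA
        obtain ⟨K, h1, h2, h3⟩ := exists_component (Near nb) hA.2
        exact ⟨K, h1, h2, trivial, h3⟩)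
    simp only [and_true] at h1
    have h2 : ∑ A ∈ ((insert v Λ).powerset.filter (Small nb)).filter (fun A => v ∉ A), wt nb m A
        ≤ ∑ B ∈ Λ.powerset.filter (Small nb), wt nb m B := by
      refine sum_le_sum_of_subset_of_nonneg ?_ fun _ _ _ => wt_nonneg _ _
      intro A hA
      simp only [mem_filter, mem_powerset] at hA ⊢
      exact ⟨(subset_insert_iff_of_notMem hA.2).1 hA.1.1, hA.1.2⟩
    have h3 : 0 ≤ ∑ B ∈ Λ.powerset.filter (Small nb), wt nb m B :=
      sum_nonneg fun _ _ => wt_nonneg _ _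
    have h4 := mul_le_mul_of_nonneg_right (hε v) h3
    nlinarith

theorem sum_Phi_succ_le (h : IsReg nb d) (m : ℕ) {ε : ℝ} (hε0 : 0 ≤ ε)
    (hε : ∀ v, ∑ K ∈ univ.filter (fun K => LinkedFrom (Near nb) v K ∧ Small nb K), wt nb m K ≤ ε)
    (S : Finset V) : ∑ A ∈ S.powerset.filter (Small nb), (Phi nb (m + 1) A : ℝ) ≤
      2 ^ S.card * (1 + ε) ^ S.card := by
  have hsw : ∑ A ∈ S.powerset.filter (Small nb), (Phi nb (m + 1) A : ℝ) ≤
      ∑ B ∈ S.powerset.filter (Small nb), 2 ^ S.card * wt nb m B := by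
    simp only [Phi, Nat.cast_sum]
    rw [sum_comm' (t' := univ.filter fun B => Small nb B ∧ nbhd nb B ⊆ S)
      (s' := fun B => (S.powerset.filter (Small nb)).filter fun A => nbhd nb B ⊆ A)]
    · have hsub : (univ.filter fun B => Small nb B ∧ nbhd nb B ⊆ S) ⊆
          S.powerset.filter (Small nb) := by
        intro B hB
        simp only [mem_filter, mem_univ, true_and, mem_powerset] at hB ⊢
        exact ⟨(h.subset_nbhd B).trans hB.2, hB.1⟩
      refine le_trans (sum_le_sum fun B hB => ?_) (sum_le_sum_of_subset_of_nonneg hsub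
        fun _ _ _ => mul_nonneg (by positivity) (wt_nonneg _ _))
      simp only [mem_filter, mem_univ, true_and] at hB
      rw [sum_const, nsmul_eq_mul]
      have hc : ((S.powerset.filter (Small nb)).filter fun A => nbhd nb B ⊆ A).card ≤
          2 ^ (S.card - (nbhd nb B).card) := by
        rw [← card_Icc_finset hB.2]
        refine card_le_card fun A hA => ?_
        simp only [mem_filter, mem_powerset] at hA
        simp [hA.1.1, hA.2]
      have hle := card_le_card hB.2
      calc _ ≤ ((2 ^ (S.card - (nbhd nb B).card) : ℕ) : ℝ) * Phi nb m B := by gcongr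
        _ = _ := by
          rw [wt]; push_cast
          rw [pow_sub₀ _ (by norm_num) hle]
          field_simp
    · intro A B
      simp only [mem_filter, mem_univ, true_and, mem_powerset]
      constructor
      · rintro ⟨⟨h1, h2⟩, h3⟩
        exact ⟨⟨⟨h1, h2⟩, h3⟩, h.small_of_nbhd_subset h2 h3, h3.trans h1⟩
      · rintro ⟨⟨⟨h1, h2⟩, h3⟩, -, -⟩
        exact ⟨⟨h1, h2⟩, h3⟩
  refine hsw.trans ?_
  rw [← mul_sum]
  gcongr
  exact h.sum_wt_le m hε0 hε S

end IsReg

/-- The points all but fewer than `ψ` of whose neighbours are adjacent to `U`. -/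
def mostly (nb : V → Finset V) (ψ : ℕ) (U : Finset V) : Finset V :=
  univ.filter fun x => (nb x \ nbhd nb U).card < ψ

/-- The outer approximation determined by `U` and `Y`. -/
def outer (nb : V → Finset V) (ψ : ℕ) (U Y : Finset V) : Finset V :=
  mostly nb ψ U \ nbhd nb Y

/-- The inner approximation of the neighbourhood determined by `U` and `Y`. -/
def innerNbhd (nb : V → Finset V) (ψ : ℕ) (U Y : Finset V) : Finset V :=
  nbhd nb U ∪ univ.filter fun y => ψ ≤ (nb y ∩ outer nb ψ U Y).card

/-- The threefold composition of nearness. -/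
def FarNear {V : Type*} (nb : V → Finset V) (x y : V) : Prop :=
  ∃ a b, Near nb x a ∧ Near nb a b ∧ Near nb b y

theorem sum_card_inter_comm {nb : V → Finset V} (hsymm : ∀ x y, y ∈ nb x → x ∈ nb y)
    (A B : Finset V) : ∑ x ∈ A, (nb x ∩ B).card = ∑ y ∈ B, (nb y ∩ A).card := by
  have e : ∀ (C : Finset V) (x : V), (nb x ∩ C).card = ∑ y ∈ C, if y ∈ nb x then 1 else 0 := by
    intro C x
    rw [inter_comm, ← filter_mem_eq_inter, card_filter]
  simp only [e]
  rw [sum_comm]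
  refine sum_congr rfl fun y _ => sum_congr rfl fun x _ => ?_
  have : y ∈ nb x ↔ x ∈ nb y := ⟨hsymm _ _, hsymm _ _⟩
  simp [this]

theorem near_iff {V : Type*} {nb : V → Finset V} {x y : V} :
    Near nb x y ↔ ∃ z, z ∈ nb x ∧ z ∈ nb y := by
  simp [Near, Finset.not_disjoint_iff]

namespace IsReg

variable {nb : V → Finset V} {d : ℕ}

theorem near_self (h : IsReg nb d) (x : V) : Near nb x x := near_iff.2 ⟨x, h.refl x, h.refl x⟩

theorem near_symm {x y : V} (hxy : Near nb x y) : Near nb y x := fun hd => hxy hd.symm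

theorem card_nbhd_le (h : IsReg nb d) (A : Finset V) : (nbhd nb A).card ≤ d * A.card := by
  refine card_biUnion_le.trans ?_
  simp [h.card, mul_comm]

theorem card_near_le (h : IsReg nb d) (x : V) : (univ.filter (Near nb x)).card ≤ d ^ 2 := by
  calc _ ≤ (nbhd nb (nb x)).card := card_le_card fun y hy => by
        obtain ⟨z, hz, hz'⟩ := near_iff.1 (mem_filter.1 hy).2
        exact mem_nbhd.2 ⟨z, hz, h.symm _ _ hz'⟩
    _ ≤ _ := (h.card_nbhd_le _).trans (by rw [h.card, sq])

theorem card_farNear_le (h : IsReg nb d) (x : V) : (univ.filter (FarNear nb x)).card ≤ d ^ 6 := by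
  have e : univ.filter (FarNear nb x) ⊆
      (((univ.filter (Near nb x)).biUnion fun a => univ.filter (Near nb a)).biUnion
        fun b => univ.filter (Near nb b)) := by
    intro y hy
    obtain ⟨a, b, h1, h2, h3⟩ := (mem_filter.1 hy).2
    simp only [mem_biUnion, mem_filter, mem_univ, true_and]
    exact ⟨b, ⟨a, h1, h2⟩, h3⟩
  have e2 : ∀ B : Finset V, (B.biUnion fun a => univ.filter (Near nb a)).card ≤ B.card * d ^ 2 :=
    fun B => card_biUnion_le_card_mul _ _ _ fun a _ => h.card_near_le a
  calc _ ≤ _ := card_le_card e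
    _ ≤ d ^ 2 * d ^ 2 * d ^ 2 := (e2 _).trans (by
        gcongr
        exact (e2 _).trans (by gcongr; exact h.card_near_le x))
    _ = d ^ 6 := by ring

theorem card_core_nbhd_le (h : IsReg nb d) (K : Finset V) :
    (core nb (nbhd nb K)).card ≤ (nbhd nb K).card :=
  card_le_card (h.core_subset _)

theorem near_of_mem_mostly (h : IsReg nb d) {ψ : ℕ} (hψ : ψ ≤ d) {U : Finset V} {x : V}
    (hx : (nb x \ nbhd nb U).card < ψ) : ∃ z, z ∈ nb x ∧ z ∈ nbhd nb U := by
  by_contra! hcon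
  rw [sdiff_eq_self_of_disjoint (Finset.disjoint_left.2 hcon), h.card] at hx
  omega

theorem exists_net (h : IsReg nb d) {ψ : ℕ} (hψ0 : 0 < ψ) (hψ : ψ ≤ d) {v : V} {K : Finset V}
    (hK : LinkedFrom (Near nb) v K) :
    ∃ U, LinkedFrom (FarNear nb) v U ∧ nbhd nb U ⊆ nbhd nb K ∧
      ψ * U.card ≤ (nbhd nb K).card + ψ ∧
      ∀ x ∈ core nb (nbhd nb K), (nb x \ nbhd nb U).card < ψ := by
  set G := nbhd nb K with hG
  set X := core nb G with hX
  have hKX : K ⊆ X := subset_core_nbhd nb K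
  obtain ⟨U, hU, hmax⟩ := exists_max_image
    (X.powerset.filter fun U => v ∈ U ∧ ψ * U.card ≤ (nbhd nb U).card + ψ) Finset.card
    ⟨{v}, by simp [hKX hK.1]⟩
  simp only [mem_filter, mem_powerset] at hU hmax
  obtain ⟨hUX, hvU, hUc⟩ := hU
  have hUG : nbhd nb U ⊆ G := (nbhd_mono nb hUX).trans (h.nbhd_core_subset _)
  have hnet : ∀ x ∈ X, (nb x \ nbhd nb U).card < ψ := by
    intro x hx
    by_contra! hcon
    have hxU : x ∉ U := by
      intro hxU
      have he : nb x \ nbhd nb U = ∅ :=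
        sdiff_eq_empty_iff_subset.2 (subset_biUnion_of_mem nb hxU)
      rw [he, card_empty] at hcon
      omega
    have hcn : (nbhd nb (insert x U)).card = (nb x \ nbhd nb U).card + (nbhd nb U).card := by
      rw [nbhd, biUnion_insert, ← card_sdiff_add_card]; rfl
    have := hmax (insert x U) ⟨insert_subset hx hUX, by simp [hvU], by
      rw [hcn, card_insert_of_notMem hxU]
      linarith⟩
    rw [card_insert_of_notMem hxU] at this
    omega
  have hnear : ∀ x ∈ X, ∃ u ∈ U, Near nb x u := by
    intro x hx
    obtain ⟨z, hz, hz'⟩ := h.near_of_mem_mostly hψ (hnet x hx)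
    obtain ⟨u, hu, hzu⟩ := mem_nbhd.1 hz'
    exact ⟨u, hu, near_iff.2 ⟨z, hz, hzu⟩⟩
  refine ⟨U, ⟨hvU, fun L hLU hvL hne => ?_⟩, hUG, ?_, hnet⟩
  · by_cases hall : ∀ k ∈ K, ∃ u ∈ L, Near nb k u
    · obtain ⟨w, hwU, hwL⟩ := exists_of_ssubset (hLU.ssubset_of_ne hne)
      have hwX : nb w ⊆ G := mem_core.1 (hUX hwU)
      obtain ⟨k, hk, hwk⟩ := mem_nbhd.1 (hwX (h.refl w))
      obtain ⟨u, hu, hku⟩ := hall k hk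
      exact ⟨u, hu, w, by simp [hwU, hwL], k, w, near_symm hku,
        near_iff.2 ⟨w, hwk, h.refl w⟩, h.near_self w⟩
    · push Not at hall
      obtain ⟨k₀, hk₀, hk₀L⟩ := hall
      obtain ⟨k, hk, w, hw, hkw⟩ := hK.2 (K.filter fun k => ∃ u ∈ L, Near nb k u)
        (filter_subset _ _) (by simpa using ⟨hK.1, v, hvL, h.near_self v⟩)
        (fun he => by
          rw [← he] at hk₀
          obtain ⟨u, hu, hn⟩ := (mem_filter.1 hk₀).2
          exact hk₀L u hu hn)
      simp only [mem_filter, mem_sdiff, not_and, not_exists] at hk hw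
      obtain ⟨-, u, hu, hku⟩ := hk
      obtain ⟨u', hu', hwu⟩ := hnear w (hKX hw.1)
      refine ⟨u, hu, u', ?_, k, w, near_symm hku, hkw, hwu⟩
      rw [mem_sdiff]
      exact ⟨hu', fun hL => hw.2 hw.1 u' hL hwu⟩
  · have := card_le_card hUG
    omega

theorem card_mostly_le (h : IsReg nb d) {ψ : ℕ} (hψ0 : 0 < ψ) (hψ : 2 * ψ ≤ d) (U : Finset V) :
    (mostly nb ψ U).card ≤ 2 * (nbhd nb U).card := by
  have h1 : ∑ x ∈ mostly nb ψ U, (d - ψ) ≤ ∑ x ∈ mostly nb ψ U, (nb x ∩ nbhd nb U).card := by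
    refine sum_le_sum fun x hx => ?_
    have := (mem_filter.1 hx).2
    have h2 := card_sdiff_add_card_inter (nb x) (nbhd nb U)
    rw [h.card] at h2
    omega
  rw [sum_card_inter_comm h.symm] at h1
  have h2 : ∑ y ∈ nbhd nb U, (nb y ∩ mostly nb ψ U).card ≤ ∑ y ∈ nbhd nb U, d :=
    sum_le_sum fun y _ => (card_le_card inter_subset_left).trans (h.card y).le
  have h3 := h1.trans h2
  simp only [sum_const, smul_eq_mul] at h3
  have h4 : (mostly nb ψ U).card * d ≤ (mostly nb ψ U).card * (2 * (d - ψ)) :=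
    Nat.mul_le_mul_left _ (by omega)
  have h5 : (mostly nb ψ U).card * d ≤ (2 * (nbhd nb U).card) * d := by
    calc _ ≤ _ := h4
      _ = 2 * ((mostly nb ψ U).card * (d - ψ)) := by ring
      _ ≤ 2 * ((nbhd nb U).card * d) := by gcongr
      _ = _ := by ring
  exact Nat.le_of_mul_le_mul_right h5 (by omega)

theorem exists_cut (h : IsReg nb d) {ψ : ℕ} (hψ0 : 0 < ψ) (hψ : ψ ≤ d) (U G : Finset V) :
    ∃ Y ⊆ nbhd nb (nbhd nb (nbhd nb U)), Disjoint Y G ∧ ψ * Y.card ≤ (mostly nb ψ U).card ∧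
      ∀ y ∉ G, (nb y ∩ outer nb ψ U Y).card < ψ := by
  set S := mostly nb ψ U with hS
  obtain ⟨Y, hY, hmax⟩ := exists_max_image
    ((nbhd nb S).powerset.filter fun Y => Disjoint Y G ∧ ψ * Y.card ≤ (S ∩ nbhd nb Y).card)
    Finset.card
    ⟨∅, by simp⟩
  simp only [mem_filter, mem_powerset] at hY hmax
  obtain ⟨hYS, hYG, hYc⟩ := hY
  have hSU : S ⊆ nbhd nb (nbhd nb U) := by
    intro x hx
    obtain ⟨z, hz, hz'⟩ := h.near_of_mem_mostly hψ (mem_filter.1 hx).2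
    exact mem_nbhd.2 ⟨z, hz', h.symm _ _ hz⟩
  refine ⟨Y, hYS.trans (nbhd_mono nb hSU), hYG, hYc.trans (card_le_card inter_subset_left), ?_⟩
  intro y hyG
  by_contra! hcon
  have hyY : y ∉ Y := by
    intro hyY
    have : nb y ∩ outer nb ψ U Y = ∅ := by
      rw [← Finset.disjoint_iff_inter_eq_empty]
      exact disjoint_of_subset_left (subset_biUnion_of_mem nb hyY) disjoint_sdiff
    rw [this, card_empty] at hcon
    omega
  have hyS : y ∈ nbhd nb S := by
    obtain ⟨x, hx⟩ := card_pos.1 (hψ0.trans_le hcon)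
    simp only [mem_inter, outer, mem_sdiff] at hx
    exact mem_nbhd.2 ⟨x, hx.2.1, h.symm _ _ hx.1⟩
  have := hmax (insert y Y) ⟨insert_subset hyS hYS, by simp [hyG, hYG], by
    rw [card_insert_of_notMem hyY, mul_add, mul_one]
    have he : S ∩ nbhd nb (insert y Y) = (S ∩ nbhd nb Y) ∪ (nb y ∩ outer nb ψ U Y) := by
      ext x
      simp only [nbhd, biUnion_insert, outer, mem_inter, mem_union, mem_sdiff, ← hS]
      tauto
    rw [he, card_union_of_disjoint]
    · omega
    · refine Finset.disjoint_left.2 fun x hx hx' => ?_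
      simp only [mem_inter, outer, mem_sdiff] at hx hx'
      exact hx'.2.2 hx.2⟩
  rw [card_insert_of_notMem hyY] at this
  omega

theorem card_approx_le (h : IsReg nb d) {ψ : ℕ} {K U Y : Finset V}
    (hUG : nbhd nb U ⊆ nbhd nb K) (hXS : core nb (nbhd nb K) ⊆ outer nb ψ U Y) :
    (d - ψ) * ((nbhd nb K \ innerNbhd nb ψ U Y).card +
      (outer nb ψ U Y \ core nb (nbhd nb K)).card) ≤
        d * ((nbhd nb K).card - (core nb (nbhd nb K)).card) := by
  set G := nbhd nb K with hG
  set X := core nb G with hX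
  set S := outer nb ψ U Y with hS
  set F := innerNbhd nb ψ U Y with hF
  have h1 : ∑ y ∈ G, (nb y ∩ X).card = d * X.card := by
    rw [sum_card_inter_comm h.symm, mul_comm, ← smul_eq_mul, ← sum_const]
    refine sum_congr rfl fun x hx => ?_
    rw [inter_eq_left.2 (mem_core.1 hx), h.card]
  have h2 : ∑ y ∈ G, (nb y ∩ (S \ X)).card ≥ (d - ψ) * (S \ X).card := by
    rw [sum_card_inter_comm h.symm, mul_comm, ← smul_eq_mul, ← sum_const]
    refine sum_le_sum fun x hx => ?_
    have hx1 : x ∈ mostly nb ψ U := (mem_sdiff.1 (mem_sdiff.1 hx).1).1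
    have hx2 := (mem_filter.1 hx1).2
    have h3 := card_sdiff_add_card_inter (nb x) (nbhd nb U)
    rw [h.card] at h3
    have h4 : (nb x ∩ nbhd nb U).card ≤ (nb x ∩ G).card :=
      card_le_card (inter_subset_inter_left hUG)
    omega
  have h3 : ∑ y ∈ G, (nb y \ S).card ≥ (d - ψ) * (G \ F).card := by
    rw [mul_comm, ← smul_eq_mul, ← sum_const]
    refine le_trans (sum_le_sum fun y hy => ?_) (sum_le_sum_of_subset sdiff_subset)
    have hyF := (mem_sdiff.1 hy).2
    simp only [hF, innerNbhd, mem_union, mem_filter, mem_univ, true_and, not_or, not_le,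
      ← hS] at hyF
    have h3 := card_sdiff_add_card_inter (nb y) S
    rw [h.card] at h3
    omega
  have h4 : ∑ y ∈ G, ((nb y ∩ X).card + (nb y ∩ (S \ X)).card + (nb y \ S).card) = d * G.card := by
    rw [mul_comm, ← smul_eq_mul, ← sum_const]
    refine sum_congr rfl fun y _ => ?_
    rw [← card_union_of_disjoint, ← inter_union_distrib_left, union_sdiff_of_subset hXS, add_comm,
      card_sdiff_add_card_inter, h.card]
    exact disjoint_of_subset_left inter_subset_right
      (disjoint_of_subset_right inter_subset_right disjoint_sdiff)
  rw [sum_add_distrib, sum_add_distrib, h1] at h4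
  rw [Nat.mul_sub, mul_add]
  omega

/-- The container lemma: every linked set admits a cheap outer approximation `S` whose
size either falls short of that of the neighbourhood, or from which the neighbourhood can be
recovered at little cost. -/
theorem exists_approx (h : IsReg nb d) {ψ : ℕ} (hψ0 : 0 < ψ) (hψ : 2 * ψ ≤ d) {v : V}
    {K : Finset V} (hK : LinkedFrom (Near nb) v K) :
    ∃ U Y, LinkedFrom (FarNear nb) v U ∧ nbhd nb U ⊆ nbhd nb K ∧
      ψ * U.card ≤ (nbhd nb K).card + ψ ∧ Y ⊆ nbhd nb (nbhd nb (nbhd nb U)) ∧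
      ψ * Y.card ≤ 2 * (nbhd nb K).card ∧ core nb (nbhd nb K) ⊆ outer nb ψ U Y ∧
      innerNbhd nb ψ U Y ⊆ nbhd nb K := by
  obtain ⟨U, hU1, hU2, hU3, hU4⟩ := h.exists_net hψ0 (by omega) hK
  obtain ⟨Y, hY1, hY2, hY3, hY4⟩ := h.exists_cut hψ0 (show ψ ≤ d by omega) U (nbhd nb K)
  refine ⟨U, Y, hU1, hU2, hU3, hY1, ?_, ?_, ?_⟩
  · have h1 := h.card_mostly_le hψ0 hψ U
    have h2 := card_le_card hU2
    omega
  · intro x hx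
    rw [outer, mem_sdiff]
    refine ⟨by simpa [mostly] using hU4 x hx, fun hxY => ?_⟩
    obtain ⟨y, hy, hxy⟩ := mem_nbhd.1 hxY
    exact Finset.disjoint_left.1 hY2 hy (mem_core.1 hx (h.symm _ _ hxy))
  · intro y hy
    rcases mem_union.1 hy with hy | hy
    · exact hU2 hy
    · by_contra hyG
      have := hY4 y hyG
      have := (mem_filter.1 hy).2
      omega

theorem exists_cover {K F : Finset V} (hF : F ⊆ nbhd nb K) :
    ∃ Z ⊆ K, Z.card ≤ (nbhd nb K \ F).card ∧ nbhd nb K = F ∪ nbhd nb Z := by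
  have : ∀ y ∈ nbhd nb K \ F, ∃ x ∈ K, y ∈ nb x := fun y hy => mem_nbhd.1 (mem_sdiff.1 hy).1
  choose! c hcK hc using this
  have hZ : (nbhd nb K \ F).image c ⊆ K := by
    intro x hx
    obtain ⟨y, hy, rfl⟩ := mem_image.1 hx
    exact hcK y hy
  refine ⟨_, hZ, card_image_le, Subset.antisymm (fun y hy => ?_)
    (union_subset hF (nbhd_mono nb hZ))⟩
  by_cases hyF : y ∈ F
  · simp [hyF]
  · have hy' : y ∈ nbhd nb K \ F := by simp [hy, hyF]
    exact mem_union_right _ (mem_nbhd.2 ⟨c y, mem_image_of_mem c hy', hc y hy'⟩)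

end IsReg

theorem sum_le_of_containers {ι : Type*} {nb : V → Finset V} {w : Finset V → ℝ} {C : ℝ}
    (hw : ∀ A, 0 ≤ w A)
    (hM : ∀ S : Finset V, ∑ A ∈ S.powerset.filter (Small nb), w A ≤ C * 2 ^ S.card) (hC : 0 ≤ C)
    (I : Finset ι) (S : ι → Finset V) (b : ℕ) (c : Finset (Finset V))
    (hc : ∀ K ∈ c, Small nb K ∧ ∃ i ∈ I, K ⊆ S i ∧ (S i).card ≤ b) :
    ∑ K ∈ c, w K ≤ I.card * (C * 2 ^ b) := by
  rcases c.eq_empty_or_nonempty with rfl | ⟨K₀, hK₀⟩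
  · simp only [sum_empty]; positivity
  obtain ⟨-, i₀, -⟩ := hc K₀ hK₀
  have : Inhabited ι := ⟨i₀⟩
  have hc' : ∀ K ∈ c, ∃ i ∈ I, K ⊆ S i ∧ (S i).card ≤ b := fun K hK => (hc K hK).2
  choose! f hfI hfS hfb using hc'
  rw [← sum_fiberwise_of_maps_to hfI, ← nsmul_eq_mul, ← sum_const]
  refine sum_le_sum fun i _ => ?_
  rcases (c.filter fun K => f K = i).eq_empty_or_nonempty with he | ⟨K₁, hK₁⟩
  · rw [he, sum_empty]; positivity
  · obtain ⟨hK₁, rfl⟩ := mem_filter.1 hK₁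
    calc _ ≤ ∑ A ∈ (S (f K₁)).powerset.filter (Small nb), w A := by
          refine sum_le_sum_of_subset_of_nonneg (fun K hK => ?_) fun _ _ _ => hw _
          obtain ⟨hK, he⟩ := mem_filter.1 hK
          rw [mem_filter, mem_powerset, ← he]
          exact ⟨hfS K hK, (hc K hK).1⟩
      _ ≤ C * 2 ^ (S (f K₁)).card := hM _
      _ ≤ _ := by
        gcongr
        · norm_num
        · exact hfb _ (mem_filter.1 hK₁).1

theorem IsReg.sum_class_le {nb : V → Finset V} {d : ℕ} (h : IsReg nb d) {ψ : ℕ} (hψ0 : 0 < ψ)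
    (hψ : 2 * ψ ≤ d) (v : V) {w : Finset V → ℝ} {C : ℝ} (hw : ∀ A, 0 ≤ w A)
    (hM : ∀ S : Finset V, ∑ A ∈ S.powerset.filter (Small nb), w A ≤ C * 2 ^ S.card) (hC : 0 ≤ C)
    {g a t s τ b : ℕ} {R : ℝ} (hg : g = a + t) (hs : 2 * g ≤ ψ * s) (hs' : g + ψ ≤ ψ * s)
    (hR1 : 1 ≤ R) (hR : 2 * g ≤ R * τ)
    (hb : ∀ z, (d - ψ) * (τ + 1 + z) ≤ d * t → a + z ≤ b) :
    ∑ K ∈ univ.filter (fun K => LinkedFrom (Near nb) v K ∧ Small nb K ∧ (nbhd nb K).card = g ∧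
      (core nb (nbhd nb K)).card = a), w K ≤
      (3 * (d ^ 6 + 1)) ^ s * (3 * d ^ 3) ^ s * (C * 2 ^ b) +
      (3 * (d ^ 6 + 1)) ^ s * (3 * d ^ 3) ^ s * (3 * R) ^ τ * (C * 2 ^ a) := by
  have hd1 : 1 ≤ d := by omega
  set c := univ.filter (fun K => LinkedFrom (Near nb) v K ∧ Small nb K ∧ (nbhd nb K).card = g ∧
      (core nb (nbhd nb K)).card = a) with hcdef
  set I₁ := univ.filter fun U => LinkedFrom (FarNear nb) v U ∧ U.card ≤ s with hI₁
  have hI₁c : (I₁.card : ℝ) ≤ (3 * (d ^ 6 + 1)) ^ s := by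
    have := card_linkedFrom_le (FarNear nb) (D := d ^ 6) (by positivity) h.card_farNear_le v s
    exact_mod_cast this
  set I₂ : Finset (Σ _ : Finset V, Finset V) := I₁.sigma fun U =>
    (nbhd nb (nbhd nb (nbhd nb U))).powerset.filter fun Y => Y.card ≤ s with hI₂
  have hI₂c : (I₂.card : ℝ) ≤ (3 * (d ^ 6 + 1)) ^ s * (3 * d ^ 3) ^ s := by
    rw [hI₂, card_sigma, Nat.cast_sum]
    calc _ ≤ ∑ U ∈ I₁, ((3 * d ^ 3) ^ s : ℝ) := by
          refine sum_le_sum fun U hU => ?_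
          refine card_powerset_filter_le _ (one_le_pow₀ (by exact_mod_cast hd1)) s ?_
          have h1 := (mem_filter.1 hU).2.2
          have h2 : (nbhd nb (nbhd nb (nbhd nb U))).card ≤ d ^ 3 * s := by
            calc _ ≤ d * (d * (d * U.card)) := (h.card_nbhd_le _).trans (by
                  gcongr
                  exact (h.card_nbhd_le _).trans (by gcongr; exact h.card_nbhd_le _))
              _ ≤ d * (d * (d * s)) := by gcongr
              _ = _ := by ring
          exact_mod_cast h2
      _ ≤ _ := by rw [sum_const, nsmul_eq_mul]; gcongr
  set I₃ : Finset (Σ _ : (Σ _ : Finset V, Finset V), Finset V) :=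
    (I₂.filter fun p => (outer nb ψ p.1 p.2).card ≤ 2 * g).sigma fun p =>
      (outer nb ψ p.1 p.2).powerset.filter fun Z => Z.card ≤ τ with hI₃
  have hI₃c : (I₃.card : ℝ) ≤ (3 * (d ^ 6 + 1)) ^ s * (3 * d ^ 3) ^ s * (3 * R) ^ τ := by
    rw [hI₃, card_sigma, Nat.cast_sum]
    calc _ ≤ ∑ p ∈ I₂.filter (fun p => (outer nb ψ p.1 p.2).card ≤ 2 * g), (3 * R) ^ τ := by
          refine sum_le_sum fun p hp => card_powerset_filter_le _ hR1 τ ?_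
          have h1 := (mem_filter.1 hp).2
          calc ((outer nb ψ p.1 p.2).card : ℝ) ≤ ((2 * g : ℕ) : ℝ) := by exact_mod_cast h1
            _ ≤ _ := by push_cast; exact hR
      _ ≤ _ := by
        rw [sum_const, nsmul_eq_mul]
        gcongr
        refine le_trans ?_ hI₂c
        exact_mod_cast card_le_card (filter_subset _ _)
  have happ : ∀ K ∈ c, ∃ p ∈ I₂, (outer nb ψ p.1 p.2).card ≤ 2 * g ∧
      nbhd nb p.1 ⊆ nbhd nb K ∧ core nb (nbhd nb K) ⊆ outer nb ψ p.1 p.2 ∧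
      innerNbhd nb ψ p.1 p.2 ⊆ nbhd nb K := by
    intro K hK
    obtain ⟨hl, -, hKg, hKa⟩ := (mem_filter.1 hK).2
    obtain ⟨U, Y, h1, h2, h3, h4, h5, h6, h7⟩ := h.exists_approx hψ0 hψ hl
    rw [hKg] at h3 h5
    refine ⟨⟨U, Y⟩, ?_, ?_, h2, h6, h7⟩
    · simp only [hI₂, hI₁, mem_sigma, mem_filter, mem_univ, true_and, mem_powerset]
      exact ⟨⟨h1, Nat.le_of_mul_le_mul_left (h3.trans hs') hψ0⟩, h4,
        Nat.le_of_mul_le_mul_left (h5.trans hs) hψ0⟩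
    · calc _ ≤ (mostly nb ψ U).card := card_le_card sdiff_subset
        _ ≤ _ := h.card_mostly_le hψ0 hψ U
        _ ≤ _ := by
          have := card_le_card h2
          omega
  set Q : Finset V → Prop := fun K => ∃ p ∈ I₂, (core nb (nbhd nb K)) ⊆ outer nb ψ p.1 p.2 ∧
    (outer nb ψ p.1 p.2).card ≤ b with hQ
  rw [← sum_filter_add_sum_filter_not c Q]
  refine add_le_add ?_ ?_
  · refine (sum_le_of_containers hw hM hC I₂ (fun p => outer nb ψ p.1 p.2) b _ ?_).trans ?_
    · intro K hK
      obtain ⟨hK, p, hp, h1, h2⟩ := mem_filter.1 hK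
      exact ⟨(mem_filter.1 hK).2.2.1, p, hp, (subset_core_nbhd nb K).trans h1, h2⟩
    · gcongr
  · refine (sum_le_of_containers hw hM hC I₃
      (fun q => core nb (innerNbhd nb ψ q.1.1 q.1.2 ∪ nbhd nb q.2)) a _ ?_).trans ?_
    · intro K hK
      obtain ⟨hK, hnQ⟩ := mem_filter.1 hK
      obtain ⟨p, hp, hp2, hp3, hp4, hp5⟩ := happ K hK
      obtain ⟨hl, hsm, hKg, hKa⟩ := (mem_filter.1 hK).2
      obtain ⟨Z, hZK, hZc, hZ⟩ := exists_cover (nb := nb) hp5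
      have hKc := subset_core_nbhd nb K
      have hτ : (nbhd nb K \ innerNbhd nb ψ p.1 p.2).card ≤ τ := by
        by_contra! hcon
        refine hnQ ⟨p, hp, hp4, ?_⟩
        have h1 := h.card_approx_le hp3 hp4
        rw [hKg, hKa, show g - a = t by omega] at h1
        have h2 := hb (outer nb ψ p.1 p.2 \ core nb (nbhd nb K)).card
          (le_trans (Nat.mul_le_mul_left _ (by omega)) h1)
        rw [← hKa, add_comm, card_sdiff_add_card_eq_card hp4] at h2
        exact h2
      refine ⟨hsm, ⟨p, Z⟩, ?_, ?_, ?_⟩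
      · simp only [hI₃, mem_sigma, mem_filter, mem_powerset]
        exact ⟨⟨hp, hp2⟩, hZK.trans (hKc.trans hp4), hZc.trans hτ⟩
      · simpa only [← hZ] using hKc
      · simp only [← hZ]; exact hKa.le
    · gcongr

/-- The range of degrees handled with the scale parameter `2 ^ l`. -/
structure ScaleFor (l d : ℕ) : Prop where
  lower : 2 ^ (8 * l) ≤ d
  upper : d ≤ 2 ^ (8 * l + 8)
  large : 1040 * (72 * l + 77) ≤ 2 ^ l

theorem add_div_le_of_mul_le {q d t z : ℕ} (hq : 4 ≤ q) (hd : q ^ 8 ≤ d)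
    (hz : (d - q ^ 6) * (t / q + 1 + z) ≤ d * t) : z + t / (2 * q) ≤ t := by
  have hq6 : 0 < q ^ 6 := by positivity
  have hq68 : q ^ 6 * (2 * q) + q ^ 6 ≤ q ^ 8 := by
    calc _ = q ^ 6 * (2 * q + 1) := by ring
      _ ≤ q ^ 6 * (q * q) := by gcongr; nlinarith
      _ = _ := by ring
  obtain ⟨e, rfl⟩ : ∃ e, d = e + q ^ 6 := ⟨d - q ^ 6, by omega⟩
  rw [Nat.add_sub_cancel] at hz
  have hqe : q ^ 6 * (2 * q) ≤ e := by omega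
  have hTT := Nat.div_add_mod t (2 * q)
  have hTm := Nat.mod_lt t (show 0 < 2 * q by omega)
  have h4 : 2 * (t / (2 * q)) ≤ t / q := by
    rw [mul_comm 2 q, ← Nat.div_div_eq_div_mul]
    omega
  generalize t / (2 * q) = T at *
  have h5 : q ^ 6 * t < e * (T + 1) := by
    calc q ^ 6 * t < q ^ 6 * (2 * q * (T + 1)) := by
          apply Nat.mul_lt_mul_of_pos_left _ hq6
          linarith
      _ = q ^ 6 * (2 * q) * (T + 1) := by ring
      _ ≤ _ := by gcongr
  have h6 : e * (t / q + 1 + z) < e * (t + (T + 1)) := by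
    calc _ ≤ (e + q ^ 6) * t := hz
      _ = e * t + q ^ 6 * t := by ring
      _ < e * t + e * (T + 1) := by linarith
      _ = _ := by ring
  have := lt_of_mul_lt_mul_left h6 (Nat.zero_le e)
  omega

theorem exponents_le {q l t g s D : ℕ} (hl : 1040 * (72 * l + 77) ≤ q)
    (hs : s = 2 * (g / q ^ 6) + 2) (hgt : g ≤ 64 * q ^ 4 * t) (ht : q ^ 2 ≤ t)
    (hD : 4 * q * D ≤ t) :
    (72 * l + 77) * s + D ≤ t / (2 * q) ∧ (72 * l + 77) * s + D + (10 + 5 * l) * (t / q) ≤ t := by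
  have hq0 : 0 < q := by omega
  have h1 : q ^ 2 * (g / q ^ 6) ≤ 64 * t := by
    have h2 : q ^ 4 * (q ^ 2 * (g / q ^ 6)) ≤ q ^ 4 * (64 * t) := by
      calc _ = q ^ 6 * (g / q ^ 6) := by ring
        _ ≤ g := Nat.mul_div_le _ _
        _ ≤ _ := by linarith
    exact Nat.le_of_mul_le_mul_left h2 (by positivity)
  have h3 : q ^ 2 * s ≤ 130 * t := by rw [hs]; linarith
  have h4 : q * (8 * q * ((72 * l + 77) * s)) ≤ q * t := by
    calc _ = (8 * (72 * l + 77)) * (q ^ 2 * s) := by ring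
      _ ≤ (8 * (72 * l + 77)) * (130 * t) := by gcongr
      _ = 1040 * (72 * l + 77) * t := by ring
      _ ≤ _ := by gcongr
  have h5 := Nat.le_of_mul_le_mul_left h4 hq0
  generalize (72 * l + 77) * s = E at *
  constructor
  · rw [Nat.le_div_iff_mul_le (by omega)]
    nlinarith
  · have h6 : 4 * ((10 + 5 * l) * (t / q)) ≤ t := by
      calc _ = (4 * (10 + 5 * l)) * (t / q) := by ring
        _ ≤ q * (t / q) := by gcongr; omega
        _ ≤ t := Nat.mul_div_le _ _
    have h7 : 8 * E ≤ t := by nlinarith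
    have h8 : 4 * D ≤ t := by nlinarith
    omega

theorem scale_bounds {q t g s : ℕ} (hq : 0 < q) (hs : s = 2 * (g / q ^ 6) + 2)
    (hgt : g ≤ 64 * q ^ 4 * t) (hqt : q ≤ t) :
    2 * g ≤ q ^ 6 * s ∧ g + q ^ 6 ≤ q ^ 6 * s ∧ 2 * g ≤ 256 * q ^ 5 * (t / q) := by
  have hgq := Nat.div_add_mod g (q ^ 6)
  have hgm := Nat.mod_lt g (show 0 < q ^ 6 by positivity)
  have htq := Nat.div_add_mod t q
  have htm := Nat.mod_lt t hq
  have h1 : q ^ 6 * s = 2 * (q ^ 6 * (g / q ^ 6)) + 2 * q ^ 6 := by rw [hs]; ring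
  refine ⟨by omega, by omega, ?_⟩
  calc 2 * g ≤ 128 * q ^ 4 * t := by linarith
    _ ≤ 128 * q ^ 4 * (2 * (q * (t / q))) := by
      gcongr
      have : 1 ≤ t / q := (Nat.one_le_div_iff hq).2 hqt
      nlinarith
    _ = _ := by ring


theorem IsReg.sum_wt_class_le {nb : V → Finset V} {d l : ℕ} (h : IsReg nb d) (hl : ScaleFor l d)
    (v : V) (m : ℕ) {C : ℝ} (hC : 0 ≤ C)
    (hM : ∀ S : Finset V, ∑ A ∈ S.powerset.filter (Small nb), (Phi nb m A : ℝ) ≤ C * 2 ^ S.card)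
    {g a t D : ℕ} (hg : g = a + t) (hgt : g ≤ 64 * (2 ^ l) ^ 4 * t) (ht : (2 ^ l) ^ 2 ≤ t)
    (hD : 4 * 2 ^ l * D ≤ t) :
    ∑ K ∈ univ.filter (fun K => LinkedFrom (Near nb) v K ∧ Small nb K ∧ (nbhd nb K).card = g ∧
      (core nb (nbhd nb K)).card = a), wt nb m K ≤ 2 * C / 2 ^ D := by
  obtain ⟨hl1, hl2, hl3⟩ := hl
  have hlq : 80080 ≤ 2 ^ l := by omega
  have hqr : (256 * ((2 ^ l : ℕ) : ℝ) ^ 5) = 2 ^ (8 + 5 * l) := by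
    push_cast; rw [pow_add, mul_comm 5 l, pow_mul]; norm_num
  have hq8 : 2 ^ (8 * l) = (2 ^ l) ^ 8 := by rw [← pow_mul, mul_comm]
  rw [hq8] at hl1
  have hqt : 2 ^ l ≤ t := le_trans (by nlinarith) ht
  obtain ⟨s, hs⟩ : ∃ s, s = 2 * (g / (2 ^ l) ^ 6) + 2 := ⟨_, rfl⟩
  obtain ⟨hb1, hb2, hb3⟩ := scale_bounds (by positivity) hs hgt hqt
  obtain ⟨he1, he2⟩ := exponents_le hl3 hs hgt ht hD
  have hTt : t / (2 * 2 ^ l) ≤ t := Nat.div_le_self _ _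
  have h2ψ : 2 * (2 ^ l) ^ 6 ≤ d := by
    calc _ ≤ (2 ^ l) ^ 2 * (2 ^ l) ^ 6 := by gcongr; nlinarith
      _ = (2 ^ l) ^ 8 := by ring
      _ ≤ d := hl1
  have key := h.sum_class_le (ψ := (2 ^ l) ^ 6) (by positivity) h2ψ v
    (w := fun A => (Phi nb m A : ℝ)) (C := C) (fun _ => by positivity) hM hC (g := g) (a := a)
    (t := t) (s := s) (τ := t / 2 ^ l) (b := a + (t - t / (2 * 2 ^ l)))
    (R := 256 * ((2 ^ l : ℕ) : ℝ) ^ 5) hg hb1 hb2 (by rw [hqr]; exact one_le_pow₀ (by norm_num))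
    (by exact_mod_cast hb3) (by
      intro z hz
      have := add_div_le_of_mul_le (by omega) hl1 hz
      omega)
  have hN : (3 * ((d : ℝ) ^ 6 + 1)) ^ s * (3 * (d : ℝ) ^ 3) ^ s ≤ 2 ^ ((72 * l + 77) * s) := by
    rw [← mul_pow, pow_mul]
    have hd1 : (1 : ℝ) ≤ d := by
      have : 0 < d := lt_of_lt_of_le (by positivity) h2ψ
      exact_mod_cast this
    have hdu : (d : ℝ) ≤ 2 ^ (8 * l + 8) := by exact_mod_cast hl2
    gcongr
    calc 3 * ((d : ℝ) ^ 6 + 1) * (3 * (d : ℝ) ^ 3) ≤ 3 * (d ^ 6 + d ^ 6) * (3 * d ^ 3) := by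
          gcongr; exact one_le_pow₀ hd1
      _ = 18 * (d : ℝ) ^ 9 := by ring
      _ ≤ 2 ^ 5 * (2 ^ (8 * l + 8)) ^ 9 := by gcongr; norm_num
      _ = _ := by rw [← pow_mul, ← pow_add]; congr 1; ring
  have hR : (3 * (256 * ((2 ^ l : ℕ) : ℝ) ^ 5)) ^ (t / 2 ^ l) ≤
      2 ^ ((10 + 5 * l) * (t / 2 ^ l)) := by
    rw [pow_mul, hqr]
    gcongr
    calc (3 : ℝ) * 2 ^ (8 + 5 * l) ≤ 2 ^ 2 * 2 ^ (8 + 5 * l) := by gcongr; norm_num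
      _ = _ := by rw [← pow_add]; congr 1; ring
  have hN0 : 0 ≤ (3 * ((d : ℝ) ^ 6 + 1)) ^ s * (3 * (d : ℝ) ^ 3) ^ s := by positivity
  have hfin : ∀ {x : ℕ}, x + D ≤ g → C * (2 : ℝ) ^ x ≤ C / 2 ^ D * 2 ^ g := by
    intro x hx
    rw [div_mul_eq_mul_div, le_div_iff₀ (by positivity), mul_assoc, ← pow_add]
    gcongr
    norm_num
  have hwt : ∑ K ∈ univ.filter (fun K => LinkedFrom (Near nb) v K ∧ Small nb K ∧
      (nbhd nb K).card = g ∧ (core nb (nbhd nb K)).card = a), wt nb m K =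
      (∑ K ∈ univ.filter (fun K => LinkedFrom (Near nb) v K ∧ Small nb K ∧
      (nbhd nb K).card = g ∧ (core nb (nbhd nb K)).card = a), (Phi nb m K : ℝ)) / 2 ^ g := by
    rw [sum_div]
    refine sum_congr rfl fun K hK => ?_
    rw [wt, (mem_filter.1 hK).2.2.2.1]
  rw [hwt, div_le_iff₀ (by positivity)]
  refine key.trans ?_
  calc _ ≤ 2 ^ ((72 * l + 77) * s) * (C * 2 ^ (a + (t - t / (2 * 2 ^ l)))) +
        2 ^ ((72 * l + 77) * s) * 2 ^ ((10 + 5 * l) * (t / 2 ^ l)) * (C * 2 ^ a) := by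
        gcongr
    _ = C * 2 ^ ((72 * l + 77) * s + (a + (t - t / (2 * 2 ^ l)))) +
        C * 2 ^ ((72 * l + 77) * s + (10 + 5 * l) * (t / 2 ^ l) + a) := by
        simp only [pow_add]; ring
    _ ≤ C / 2 ^ D * 2 ^ g + C / 2 ^ D * 2 ^ g := add_le_add (hfin (by omega)) (hfin (by omega))
    _ = _ := by ring

/-- The properties of the neighbourhoods of a cube that enter the counting argument. -/
structure Expanding (nb : V → Finset V) (l d : ℕ) : Prop where
  reg : IsReg nb d
  scale : ScaleFor l d
  pair : ∀ x y, x ≠ y → (nb x ∩ nb y).card ≤ 2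
  iso : ∀ X : Finset V, 2 * X.card ≤ Fintype.card V →
    X.card ≤ 32 * (2 ^ l) ^ 4 * ((nbhd nb X).card - X.card)
  card : 2 * Fintype.card V = 2 ^ d

theorem ScaleFor.pow_le {l d : ℕ} (hl : ScaleFor l d) : 288 * d * (d ^ 2 + 1) ^ 2 ≤ 2 ^ (d / 2) := by
  obtain ⟨h1, h2, h3⟩ := hl
  have h4 : 2 ^ l ≤ d := (Nat.pow_le_pow_right (by norm_num) (by omega)).trans h1
  have hd1 : 1 ≤ d ^ 2 := Nat.one_le_pow _ _ (by omega)
  calc 288 * d * (d ^ 2 + 1) ^ 2 ≤ 288 * d * (d ^ 2 + d ^ 2) ^ 2 := by gcongr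
    _ = 1152 * d ^ 5 := by ring
    _ ≤ 2 ^ 11 * (2 ^ (8 * l + 8)) ^ 5 := by gcongr; norm_num
    _ = 2 ^ (40 * l + 51) := by rw [← pow_mul, ← pow_add]; congr 1; ring
    _ ≤ _ := Nat.pow_le_pow_right (by norm_num) (by omega)

theorem ScaleFor.le_degree {l d : ℕ} (hl : ScaleFor l d) : 80080 ≤ d := by
  obtain ⟨h1, h2, h3⟩ := hl
  have h4 : 2 ^ l ≤ d := (Nat.pow_le_pow_right (by norm_num) (by omega)).trans h1
  omega

namespace Expanding

variable {nb : V → Finset V} {l d : ℕ}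

theorem card_mul_le (h : Expanding nb l d) (K : Finset V) :
    K.card * d ≤ (nbhd nb K).card + K.card ^ 2 := by
  induction K using Finset.induction_on with
  | empty => simp
  | insert x K hx ih =>
    have h1 : (nb x ∩ nbhd nb K).card ≤ K.card * 2 := by
      rw [nbhd, inter_biUnion]
      exact card_biUnion_le_card_mul _ _ _ fun y hy => h.pair x y (by rintro rfl; exact hx hy)
    have h2 : (nbhd nb (insert x K)).card + (nb x ∩ nbhd nb K).card = d + (nbhd nb K).card := by
      rw [nbhd, biUnion_insert, ← h.reg.card x]
      exact card_union_add_card_inter _ _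
    rw [card_insert_of_notMem hx]
    nlinarith

theorem sum_wt_large_le (h : Expanding nb l d) (m : ℕ)
    (hM : ∀ S : Finset V, ∑ A ∈ S.powerset.filter (Small nb), (Phi nb m A : ℝ) ≤ 8 * 2 ^ S.card)
    (v : V) :
    ∑ K ∈ univ.filter (fun K => LinkedFrom (Near nb) v K ∧ Small nb K ∧ d / 4 ≤ K.card),
      wt nb m K ≤ 1 / 2 ^ (3 * d) := by
  set N := Fintype.card V with hN
  have hd := h.scale.le_degree
  have hq : 80080 ≤ 2 ^ l := by have := h.scale.large; omega
  have hmap : ∀ K ∈ univ.filter (fun K => LinkedFrom (Near nb) v K ∧ Small nb K ∧ d / 4 ≤ K.card),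
      ((nbhd nb K).card, (core nb (nbhd nb K)).card) ∈ range (N + 1) ×ˢ range (N + 1) := by
    intro K _
    simp only [mem_product, mem_range, Nat.lt_succ_iff]
    exact ⟨card_le_univ _, card_le_univ _⟩
  rw [← sum_fiberwise_of_maps_to hmap]
  have hfib : ∀ p ∈ range (N + 1) ×ˢ range (N + 1),
      ∑ K ∈ (univ.filter (fun K => LinkedFrom (Near nb) v K ∧ Small nb K ∧ d / 4 ≤ K.card)).filter
        (fun K => ((nbhd nb K).card, (core nb (nbhd nb K)).card) = p), wt nb m K ≤
        2 * 8 / 2 ^ (6 * d) := by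
    rintro ⟨g, a⟩ -
    rcases ((univ.filter (fun K => LinkedFrom (Near nb) v K ∧ Small nb K ∧
        d / 4 ≤ K.card)).filter (fun K => ((nbhd nb K).card, (core nb (nbhd nb K)).card) =
        (g, a))).eq_empty_or_nonempty with he | ⟨K, hK⟩
    · rw [he, sum_empty]; positivity
    simp only [mem_filter, mem_univ, true_and, Prod.mk.injEq] at hK
    obtain ⟨⟨hKl, hKs, hKc⟩, hKg, hKa⟩ := hK
    have hag : a ≤ g := by rw [← hKa, ← hKg]; exact h.reg.card_core_nbhd_le K
    obtain ⟨t, ht⟩ := Nat.exists_eq_add_of_le hag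
    have hiso := h.iso _ hKs
    rw [h.reg.nbhd_core_nbhd, hKa, hKg, show g - a = t by omega] at hiso
    have hgt : g ≤ 64 * (2 ^ l) ^ 4 * t := by
      have : 1 * t ≤ (2 ^ l) ^ 4 * t := Nat.mul_le_mul_right _ (Nat.one_le_pow _ _ (by omega))
      nlinarith
    have hgd : d ^ 2 ≤ 8 * g := by
      obtain ⟨K', hK', hK'c⟩ := exists_subset_card_eq hKc
      have h1 := h.card_mul_le K'
      have h2 := card_le_card (nbhd_mono nb hK')
      rw [hK'c] at h1
      rw [hKg] at h2
      have h3 : d ≤ 4 * (d / 4) + 3 := by omega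
      have h4 : 4 * (d / 4) ≤ d := by omega
      generalize d / 4 = k at *
      nlinarith
    have hdt : d * (2 ^ l) ^ 4 ≤ 512 * t := by
      have h8 : 2 ^ (8 * l) = (2 ^ l) ^ 8 := by rw [← pow_mul, mul_comm]
      have h1 := h.scale.lower
      rw [h8] at h1
      have h2 : (2 ^ l) ^ 4 * (d * (2 ^ l) ^ 4) ≤ (2 ^ l) ^ 4 * (512 * t) := by
        calc _ = d * (2 ^ l) ^ 8 := by ring
          _ ≤ d * d := by gcongr
          _ ≤ 8 * (64 * (2 ^ l) ^ 4 * t) := by nlinarith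
          _ = _ := by ring
      exact Nat.le_of_mul_le_mul_left h2 (by positivity)
    have ht1 : (2 ^ l) ^ 2 ≤ t := by
      have : 512 * (2 ^ l) ^ 2 ≤ d * (2 ^ l) ^ 4 := by
        gcongr
        · omega
        · omega
        · norm_num
      omega
    have ht2 : 4 * 2 ^ l * (6 * d) ≤ t := by
      have : 512 * (4 * 2 ^ l * (6 * d)) ≤ d * (2 ^ l) ^ 4 := by
        calc 512 * (4 * 2 ^ l * (6 * d)) = 12288 * (d * 2 ^ l) := by ring
          _ ≤ (2 ^ l) ^ 3 * (d * 2 ^ l) := by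
            gcongr
            exact le_trans (by omega) (Nat.le_self_pow (by norm_num) _)
          _ = _ := by ring
      omega
    refine le_trans (sum_le_sum_of_subset_of_nonneg (fun K hK => ?_) fun _ _ _ =>
      IsReg.wt_nonneg _ _) (h.reg.sum_wt_class_le h.scale v m (by norm_num) hM ht hgt ht1 ht2)
    simp only [mem_filter, mem_univ, true_and, Prod.mk.injEq] at hK ⊢
    exact ⟨hK.1.1, hK.1.2.1, hK.2.1, hK.2.2⟩
  refine (sum_le_sum hfib).trans ?_
  rw [sum_const, card_product, card_range, nsmul_eq_mul]
  have hN2 : ((N + 1 : ℕ) : ℝ) ≤ 2 ^ d := by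
    have h1 := h.card
    have h2 : 1 ≤ N := Fintype.card_pos_iff.2 ⟨v⟩
    have : N + 1 ≤ 2 ^ d := by omega
    exact_mod_cast this
  rw [Nat.cast_mul]
  calc _ ≤ (2 : ℝ) ^ d * 2 ^ d * (2 * 8 / 2 ^ (6 * d)) := by gcongr
    _ = 2 ^ (2 * d + 4) / 2 ^ (6 * d) := by ring
    _ ≤ 2 ^ (3 * d) / 2 ^ (6 * d) := by gcongr; norm_num; omega
    _ = _ := by
      rw [div_eq_div_iff (by positivity) (by positivity), one_mul, ← pow_add]
      congr 1; ring

theorem Phi_singleton_le (h : Expanding nb l d) (m : ℕ) (v : V) : Phi nb m {v} ≤ 1 := by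
  have hd := h.scale.le_degree
  cases m with
  | zero => simp [Phi]
  | succ m =>
    have : (univ.filter fun B => nbhd nb B ⊆ {v}) ⊆ {∅} := by
      intro B hB
      rw [mem_filter] at hB
      rw [mem_singleton]
      by_contra hne
      obtain ⟨x, hx⟩ := nonempty_iff_ne_empty.2 hne
      have := card_le_card ((subset_biUnion_of_mem nb hx).trans hB.2)
      rw [h.reg.card, card_singleton] at this
      omega
    exact (sum_le_sum_of_subset this).trans (by simp [h.reg.Phi_empty])

theorem sum_wt_small_le (h : Expanding nb l d) (m : ℕ)
    (hM : ∀ S : Finset V, ∑ A ∈ S.powerset.filter (Small nb), (Phi nb m A : ℝ) ≤ 8 * 2 ^ S.card)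
    (v : V) :
    ∑ K ∈ univ.filter (fun K => LinkedFrom (Near nb) v K ∧ Small nb K ∧ ¬ d / 4 ≤ K.card),
      wt nb m K ≤ 2 / 2 ^ d := by
  have hd := h.scale.le_degree
  set e := d - d / 4 with he
  set x : ℝ := 6 * (d ^ 2 + 1) / 2 ^ e with hx
  have hx0 : 0 ≤ x := by positivity
  have hx2 : 8 * d * x ^ 2 ≤ 1 / 2 ^ d := by
    have h1 : (288 : ℝ) * d * (d ^ 2 + 1) ^ 2 ≤ 2 ^ (d / 2) := by exact_mod_cast h.scale.pow_le
    rw [le_div_iff₀ (by positivity), hx, div_pow, ← mul_div_assoc, div_mul_eq_mul_div,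
      div_le_one (by positivity)]
    calc _ = 288 * d * (d ^ 2 + 1) ^ 2 * (2 : ℝ) ^ d := by ring
      _ ≤ 2 ^ (d / 2) * 2 ^ d := by gcongr
      _ ≤ _ := by
        rw [← pow_add, ← pow_mul]
        exact pow_le_pow_right₀ (by norm_num) (by omega)
  have hx1 : x ≤ 1 := by
    by_contra! hcon
    have h1 : (1 : ℝ) < x ^ 2 := one_lt_pow₀ hcon (by norm_num)
    have h2 : (1 : ℝ) / 2 ^ d ≤ 1 := by
      rw [div_le_one (by positivity)]; exact one_le_pow₀ (by norm_num)
    have h3 : (80080 : ℝ) ≤ d := by exact_mod_cast hd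
    nlinarith
  have hmap : ∀ K ∈ univ.filter (fun K => LinkedFrom (Near nb) v K ∧ Small nb K ∧
      ¬ d / 4 ≤ K.card), K.card ∈ insert 1 (Ico 2 (d / 4)) := by
    intro K hK
    simp only [mem_filter, mem_univ, true_and] at hK
    have := card_pos.2 ⟨v, hK.1.1⟩
    simp only [mem_insert, mem_Ico]
    omega
  rw [← sum_fiberwise_of_maps_to hmap, sum_insert (by simp)]
  have h1 : ∑ K ∈ (univ.filter (fun K => LinkedFrom (Near nb) v K ∧ Small nb K ∧
      ¬ d / 4 ≤ K.card)).filter (fun K => K.card = 1), wt nb m K ≤ 1 / 2 ^ d := by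
    refine (sum_le_sum_of_subset_of_nonneg (t := {{v}}) (fun K hK => ?_) fun _ _ _ =>
      IsReg.wt_nonneg _ _).trans ?_
    · simp only [mem_filter, mem_univ, true_and] at hK
      obtain ⟨w, rfl⟩ := card_eq_one.1 hK.2
      rw [mem_singleton.1 hK.1.1.1, mem_singleton]
    · rw [sum_singleton, wt]
      have h2 : nbhd nb {v} = nb v := by simp [nbhd]
      rw [h2, h.reg.card]
      gcongr
      exact_mod_cast h.Phi_singleton_le m v
  have h2 : ∀ k ∈ Ico 2 (d / 4), ∑ K ∈ (univ.filter (fun K => LinkedFrom (Near nb) v K ∧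
      Small nb K ∧ ¬ d / 4 ≤ K.card)).filter (fun K => K.card = k), wt nb m K ≤ 8 * x ^ 2 := by
    intro k hk
    rw [mem_Ico] at hk
    have hw : ∀ K ∈ (univ.filter (fun K => LinkedFrom (Near nb) v K ∧
      Small nb K ∧ ¬ d / 4 ≤ K.card)).filter (fun K => K.card = k),
        wt nb m K ≤ 8 * 2 ^ k / 2 ^ (e * k) := by
      intro K hK
      simp only [mem_filter, mem_univ, true_and] at hK
      obtain ⟨⟨-, hs, -⟩, hc⟩ := hK
      rw [wt]
      have h3 := h.card_mul_le K
      rw [hc] at h3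
      gcongr
      · rw [← hc]
        refine le_trans ?_ (hM K)
        exact single_le_sum (f := fun A => (Phi nb m A : ℝ)) (fun _ _ => by positivity)
          (by simp [hs])
      · norm_num
      · have h4 : (e + k) * k ≤ d * k := Nat.mul_le_mul_right _ (by omega)
        nlinarith
    refine (sum_le_sum hw).trans ?_
    rw [sum_const, nsmul_eq_mul]
    have hcard : (((univ.filter (fun K => LinkedFrom (Near nb) v K ∧
      Small nb K ∧ ¬ d / 4 ≤ K.card)).filter (fun K => K.card = k)).card : ℝ) ≤
        (3 * (d ^ 2 + 1)) ^ k := by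
      have h3 := card_linkedFrom_le (Near nb) (D := d ^ 2) (by positivity) h.reg.card_near_le v k
      push_cast at h3
      refine le_trans ?_ h3
      norm_cast
      refine card_le_card fun K hK => ?_
      simp only [mem_filter, mem_univ, true_and] at hK ⊢
      exact ⟨hK.1.1, hK.2.le⟩
    calc _ ≤ (3 * ((d : ℝ) ^ 2 + 1)) ^ k * (8 * 2 ^ k / 2 ^ (e * k)) := by gcongr
      _ = 8 * x ^ k := by
        rw [hx, div_pow, pow_mul, show 6 * ((d : ℝ) ^ 2 + 1) = 3 * (d ^ 2 + 1) * 2 by ring,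
          mul_pow _ (2 : ℝ)]
        ring
      _ ≤ _ := by
        gcongr 8 * ?_
        exact pow_le_pow_of_le_one hx0 hx1 hk.1
  have h3 : ∑ k ∈ Ico 2 (d / 4), (8 * x ^ 2) ≤ d * (8 * x ^ 2) := by
    rw [sum_const, nsmul_eq_mul]
    gcongr
    simp only [Nat.card_Ico]
    omega
  have h4 := add_le_add h1 ((sum_le_sum h2).trans h3)
  refine h4.trans ?_
  have : (2 : ℝ) / 2 ^ d = 1 / 2 ^ d + 1 / 2 ^ d := by ring
  linarith

theorem sum_wt_linked_le_of (h : Expanding nb l d) (m : ℕ)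
    (hM : ∀ S : Finset V, ∑ A ∈ S.powerset.filter (Small nb), (Phi nb m A : ℝ) ≤ 8 * 2 ^ S.card)
    (v : V) :
    ∑ K ∈ univ.filter (fun K => LinkedFrom (Near nb) v K ∧ Small nb K), wt nb m K ≤ 4 / 2 ^ d := by
  rw [← sum_filter_add_sum_filter_not _ (fun K => d / 4 ≤ K.card), filter_filter, filter_filter]
  simp only [and_assoc]
  have h1 := h.sum_wt_large_le m hM v
  have h2 := h.sum_wt_small_le m hM v
  have h3 : (1 : ℝ) / 2 ^ (3 * d) ≤ 1 / 2 ^ d := by gcongr; norm_num; omega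
  have h4 : (0 : ℝ) < 1 / 2 ^ d := by positivity
  have h5 : (4 : ℝ) / 2 ^ d = 4 * (1 / 2 ^ d) := by ring
  have h6 : (2 : ℝ) / 2 ^ d = 2 * (1 / 2 ^ d) := by ring
  linarith

theorem one_add_pow_le (h : Expanding nb l d) (S : Finset V) :
    (1 + (4 : ℝ) / 2 ^ d) ^ S.card ≤ 8 := by
  have h1 : (2 : ℝ) * Fintype.card V = 2 ^ d := by exact_mod_cast h.card
  calc (1 + (4 : ℝ) / 2 ^ d) ^ S.card ≤ Real.exp (4 / 2 ^ d) ^ S.card := by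
        gcongr
        rw [add_comm]
        exact Real.add_one_le_exp _
    _ = Real.exp (S.card * (4 / 2 ^ d)) := (Real.exp_nat_mul _ _).symm
    _ ≤ Real.exp (2 * 1) := by
      rw [Real.exp_le_exp, ← mul_div_assoc, div_le_iff₀ (by positivity), ← h1]
      have : (S.card : ℝ) ≤ Fintype.card V := by exact_mod_cast card_le_univ S
      linarith
    _ ≤ 8 := by
      have h2 := Real.exp_one_lt_d9
      have h3 := Real.exp_pos 1
      rw [two_mul, Real.exp_add]
      nlinarith

theorem sum_Phi_le (h : Expanding nb l d) (m : ℕ) (S : Finset V) :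
    ∑ A ∈ S.powerset.filter (Small nb), (Phi nb m A : ℝ) ≤ 8 * 2 ^ S.card := by
  induction m generalizing S with
  | zero =>
    have h1 : (1 : ℝ) ≤ 2 ^ S.card := one_le_pow₀ (by norm_num)
    calc _ ≤ ∑ A ∈ S.powerset, (Phi nb 0 A : ℝ) :=
          sum_le_sum_of_subset_of_nonneg (filter_subset _ _) fun _ _ _ => by positivity
      _ = 1 := by simp [Phi]
      _ ≤ _ := by linarith
  | succ m ih =>
    refine (h.reg.sum_Phi_succ_le m (by positivity) (h.sum_wt_linked_le_of m ih) S).trans ?_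
    rw [mul_comm]
    gcongr
    exact h.one_add_pow_le S

theorem sum_wt_linked_le (h : Expanding nb l d) (m : ℕ) (v : V) :
    ∑ K ∈ univ.filter (fun K => LinkedFrom (Near nb) v K ∧ Small nb K), wt nb m K ≤ 4 / 2 ^ d :=
  h.sum_wt_linked_le_of m (h.sum_Phi_le m) v

theorem sum_wt_le (h : Expanding nb l d) (m : ℕ) :
    ∑ A ∈ univ.filter (Small nb), wt nb m A ≤ 8 := by
  have := (h.reg.sum_wt_le m (by positivity) (h.sum_wt_linked_le m) univ).trans
    (h.one_add_pow_le univ)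
  simpa using this

theorem sum_wt_mem_le (h : Expanding nb l d) (m : ℕ) (v : V) :
    ∑ A ∈ univ.filter (fun A => Small nb A ∧ v ∈ A), wt nb m A ≤ 32 / 2 ^ d := by
  have h1 := h.reg.sum_component_le m v (fun _ => True) univ
    (univ.filter (fun A => Small nb A ∧ v ∈ A)) (by simp +contextual) (by
      intro A hA
      simp only [mem_filter] at hA
      obtain ⟨K, h1, h2, h3⟩ := exists_component (Near nb) hA.2.2
      exact ⟨K, h1, h2, trivial, h3⟩)
  refine h1.trans ?_
  simp only [and_true, powerset_univ]
  calc _ ≤ (4 : ℝ) / 2 ^ d * 8 := by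
        gcongr
        · exact sum_nonneg fun _ _ => IsReg.wt_nonneg _ _
        · exact h.sum_wt_linked_le m v
        · exact h.sum_wt_le m
    _ = _ := by ring

theorem sum_wt_ball_le (h : Expanding nb l d) (m : ℕ) (v : V) :
    ∑ A ∈ univ.filter (fun A => Small nb A ∧ nb v ⊆ A), wt nb m A ≤ 8 / 2 ^ (3 * d) := by
  have h1 := h.reg.sum_component_le m v (fun K => d / 4 ≤ K.card) univ
    (univ.filter (fun A => Small nb A ∧ nb v ⊆ A)) (by simp +contextual) (by
      intro A hA
      simp only [mem_filter] at hA
      obtain ⟨K, h1, h2, h3⟩ := exists_component (Near nb) (hA.2.2 (h.reg.refl v))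
      refine ⟨K, h1, h2, ?_, h3⟩
      have : nb v ⊆ K := by
        intro y hy
        by_contra hyK
        exact h3 v h2.1 y (mem_sdiff.2 ⟨hA.2.2 hy, hyK⟩) (near_iff.2 ⟨y, hy, h.reg.refl y⟩)
      have := card_le_card this
      rw [h.reg.card] at this
      omega)
  refine h1.trans ?_
  simp only [powerset_univ]
  calc _ ≤ (1 : ℝ) / 2 ^ (3 * d) * 8 := by
        gcongr
        · exact sum_nonneg fun _ _ => IsReg.wt_nonneg _ _
        · refine (le_of_eq ?_).trans (h.sum_wt_large_le m (h.sum_Phi_le m) v)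
          congr!
        · exact h.sum_wt_le m
    _ = _ := by ring

end Expanding

/-- The vertex of the cube obtained from `x` by changing coordinate `i`. -/
def flip {n : ℕ} (x : Fin n → Bool) (i : Fin n) : Fin n → Bool :=
  Function.update x i (!x i)

/-- The number of neighbours of `x` outside `C`. -/
noncomputable def outDeg {n : ℕ} (C : Finset (Fin n → Bool)) (x : Fin n → Bool) : ℕ :=
  (univ.filter fun i => flip x i ∉ C).card

/-- The slice of a set of vertices by its first coordinate. -/
noncomputable def slice {n : ℕ} (C : Finset (Fin (n + 1) → Bool)) (b : Bool) :
    Finset (Fin n → Bool) :=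
  univ.filter fun y => Fin.cons b y ∈ C

theorem sum_cons {n : ℕ} {M : Type*} [AddCommMonoid M] (F : (Fin (n + 1) → Bool) → M) :
    ∑ x, F x = ∑ y, F (Fin.cons true y) + ∑ y, F (Fin.cons false y) := by
  rw [← (Fin.consEquiv fun _ : Fin (n + 1) => Bool).sum_comp, Fintype.sum_prod_type,
    Fintype.sum_bool]
  rfl

theorem card_slice {n : ℕ} (C : Finset (Fin (n + 1) → Bool)) :
    C.card = (slice C true).card + (slice C false).card := by
  have h := sum_cons fun x => if x ∈ C then 1 else 0
  rw [slice, slice, card_filter, card_filter, ← h, ← card_filter, filter_univ_mem]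

theorem sum_slice {n : ℕ} (C : Finset (Fin (n + 1) → Bool)) (F : (Fin (n + 1) → Bool) → ℝ) :
    ∑ x ∈ C, F x = ∑ y ∈ slice C true, F (Fin.cons true y) +
      ∑ y ∈ slice C false, F (Fin.cons false y) := by
  have h := sum_cons fun x => if x ∈ C then F x else 0
  simpa [slice, sum_filter] using h

theorem outDeg_cons {n : ℕ} (C : Finset (Fin (n + 1) → Bool)) (b : Bool) (y : Fin n → Bool) :
    outDeg C (Fin.cons b y) = outDeg (slice C b) y + if y ∈ slice C (!b) then 0 else 1 := by
  have h0 : flip (Fin.cons b y : Fin (n + 1) → Bool) 0 = Fin.cons (!b) y := by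
    rw [flip, Fin.cons_zero, Fin.update_cons_zero]
  have h1 : ∀ i : Fin n, flip (Fin.cons b y : Fin (n + 1) → Bool) i.succ = Fin.cons b (flip y i) :=
    fun i => by rw [flip, flip, Fin.cons_succ, Fin.cons_update]
  rw [outDeg, Fin.card_filter_univ_succ, h0]
  simp only [h1, slice, mem_filter, mem_univ, true_and, outDeg]
  split_ifs <;> simp_all

theorem sqrt_sq_add_sq_le {α : Type*} (s : Finset α) (a b : α → ℝ) :
    √((∑ x ∈ s, a x) ^ 2 + (∑ x ∈ s, b x) ^ 2) ≤ ∑ x ∈ s, √(a x ^ 2 + b x ^ 2) := by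
  set A := ∑ x ∈ s, a x
  set B := ∑ x ∈ s, b x
  rcases (Real.sqrt_nonneg (A ^ 2 + B ^ 2)).eq_or_lt with h | h
  · rw [← h]; exact sum_nonneg fun _ _ => Real.sqrt_nonneg _
  refine le_of_mul_le_mul_left ?_ h
  rw [Real.mul_self_sqrt (by positivity), mul_sum]
  calc A ^ 2 + B ^ 2 = ∑ x ∈ s, (A * a x + B * b x) := by
        rw [sum_add_distrib, ← mul_sum, ← mul_sum]; ring
    _ ≤ _ := by
      refine sum_le_sum fun x _ => ?_
      rw [← Real.sqrt_mul (by positivity)]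
      refine Real.le_sqrt_of_sq_le ?_
      nlinarith [sq_nonneg (A * b x - B * a x)]

theorem profile_step {M p q P Q D S : ℝ} (hM : 0 < M) (hq : 0 ≤ q) (hqp : q ≤ p) (hp : p ≤ M)
    (hP : p * (M - p) / M ≤ P) (hQ : q * (M - q) / M ≤ Q) (hD : p - q ≤ D)
    (hS : √(P ^ 2 + D ^ 2) ≤ S) : (p + q) * (2 * M - (p + q)) / (2 * M) ≤ S + Q := by
  set J := p * (M - p) / M with hJ
  have hJ0 : 0 ≤ J := div_nonneg (mul_nonneg (by linarith) (by linarith)) hM.le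
  have hJM : J ≤ M / 4 := by
    rw [hJ, div_le_iff₀ hM]
    nlinarith [sq_nonneg (M - 2 * p)]
  set δ := p - q with hδ
  have hδ0 : 0 ≤ δ := by rw [hδ]; linarith
  have hδM : δ ≤ M := by rw [hδ]; linarith
  have h1 : J + δ ^ 2 / (2 * M) ≤ √(P ^ 2 + D ^ 2) := by
    refine Real.le_sqrt_of_sq_le ?_
    set r := δ / M with hr
    have hr0 : 0 ≤ r := by positivity
    have hr1 : r ≤ 1 := (div_le_one hM).2 hδM
    have hδr : δ = r * M := by rw [hr]; field_simp
    have h2 : δ ^ 2 / (2 * M) = r ^ 2 * M / 2 := by rw [hδr]; field_simp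
    have h3 : J ^ 2 ≤ P ^ 2 := by gcongr
    have h4 : δ ^ 2 ≤ D ^ 2 := by gcongr
    have h5 : (J + r ^ 2 * M / 2) ^ 2 ≤ J ^ 2 + δ ^ 2 := by
      have h6 : J * (r ^ 2 * M) ≤ M / 4 * (r ^ 2 * M) := by gcongr
      have h7 : r ^ 2 * (r ^ 2 * M ^ 2) ≤ 1 * (r ^ 2 * M ^ 2) := by
        gcongr; exact pow_le_one₀ hr0 hr1
      rw [hδr]
      nlinarith [mul_nonneg (sq_nonneg r) (sq_nonneg M)]
    rw [h2]
    linarith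
  have h2 : (p + q) * (2 * M - (p + q)) / (2 * M) =
      J + q * (M - q) / M + δ ^ 2 / (2 * M) := by
    rw [hJ, hδ]
    field_simp
    ring
  linarith

/-- The functional isoperimetric inequality for the square root of the outer degree. -/
theorem sum_sqrt_outDeg_ge (n : ℕ) : ∀ C : Finset (Fin n → Bool),
    (C.card : ℝ) * (2 ^ n - C.card) / 2 ^ n ≤ ∑ x ∈ C, √(outDeg C x) := by
  induction n with
  | zero =>
    intro C
    have h1 : C.card ≤ 1 := (card_le_univ C).trans (by simp)
    have h2 : (C.card : ℝ) * (2 ^ 0 - C.card) / 2 ^ 0 = 0 := by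
      interval_cases C.card <;> simp
    rw [h2]
    exact sum_nonneg fun _ _ => Real.sqrt_nonneg _
  | succ n ih =>
    intro C
    have key : ∀ b, (slice C (!b)).card ≤ (slice C b).card →
        (C.card : ℝ) * (2 ^ (n + 1) - C.card) / 2 ^ (n + 1) ≤
          ∑ y ∈ slice C b, √(outDeg C (Fin.cons b y)) +
          ∑ y ∈ slice C (!b), √(outDeg C (Fin.cons (!b) y)) := by
      intro b hb
      have hc : (C.card : ℝ) = (slice C b).card + (slice C (!b)).card := by
        rw [card_slice C]
        cases b <;> push_cast <;> simp [add_comm]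
      have h2 : ∑ y ∈ slice C (!b), √(outDeg (slice C (!b)) y) ≤
          ∑ y ∈ slice C (!b), √(outDeg C (Fin.cons (!b) y)) := by
        refine sum_le_sum fun y _ => Real.sqrt_le_sqrt ?_
        rw [outDeg_cons]
        exact_mod_cast Nat.le_add_right _ _
      have h3 := sqrt_sq_add_sq_le (slice C b) (fun y => √(outDeg (slice C b) y))
        (fun y => if y ∈ slice C (!b) then 0 else 1)
      have h4 : ∀ y, √(√(outDeg (slice C b) y : ℝ) ^ 2 + (if y ∈ slice C (!b) then 0 else 1) ^ 2) =
          √(outDeg C (Fin.cons b y)) := by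
        intro y
        rw [outDeg_cons, Real.sq_sqrt (by positivity)]
        split_ifs <;> simp
      simp only [h4] at h3
      have hD : ((slice C b).card : ℝ) - (slice C (!b)).card ≤
          ∑ y ∈ slice C b, (if y ∈ slice C (!b) then (0 : ℝ) else 1) := by
        have h5 : ∑ y ∈ slice C b, (if y ∈ slice C (!b) then (0 : ℝ) else 1) =
            (slice C b \ slice C (!b)).card := by
          rw [← filter_notMem_eq_sdiff, card_filter]
          push_cast
          exact sum_congr rfl fun y _ => by split_ifs <;> simp_all
        rw [h5, sub_le_iff_le_add]
        have := card_le_card_sdiff_add_card (s := slice C b) (t := slice C (!b))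
        exact_mod_cast this
      have hM : ((slice C b).card : ℝ) ≤ 2 ^ n := by
        have := card_le_univ (slice C b)
        rw [Fintype.card_fun, Fintype.card_bool, Fintype.card_fin] at this
        exact_mod_cast this
      have := profile_step (M := 2 ^ n) (by positivity) (by positivity) (by exact_mod_cast hb) hM
        (ih (slice C b)) ((ih (slice C (!b))).trans h2) hD h3
      rw [hc, pow_succ, mul_comm ((2 : ℝ) ^ n) 2]
      exact this
    rw [sum_slice]
    rcases le_total (slice C false).card (slice C true).card with h | h
    · exact key true h
    · exact (key false h).trans_eq (add_comm _ _)

/-- The closed ball of radius one. -/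
def ball {n : ℕ} (x : Fin n → Bool) : Finset (Fin n → Bool) :=
  insert x (univ.image (flip x))

theorem mem_ball {n : ℕ} {x y : Fin n → Bool} : y ∈ ball x ↔ y = x ∨ ∃ i, flip x i = y := by
  simp [ball]

theorem flip_apply_self {n : ℕ} (x : Fin n → Bool) (i : Fin n) : flip x i i = !x i := by
  simp [flip]

theorem flip_apply_of_ne {n : ℕ} (x : Fin n → Bool) {i j : Fin n} (h : j ≠ i) :
    flip x i j = x j := by
  simp [flip, h]

theorem flip_flip {n : ℕ} (x : Fin n → Bool) (i : Fin n) : flip (flip x i) i = x := by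
  ext j
  by_cases h : j = i
  · subst h; simp [flip_apply_self]
  · simp [flip_apply_of_ne _ h]

theorem flip_ne {n : ℕ} (x : Fin n → Bool) (i : Fin n) : flip x i ≠ x := fun h => by
  have := congrFun h i
  simp [flip_apply_self] at this

theorem flip_injective {n : ℕ} (x : Fin n → Bool) : Function.Injective (flip x) := by
  intro i j h
  by_contra hij
  have := congrFun h i
  simp [flip_apply_self, flip_apply_of_ne _ hij] at this

theorem eq_flip_of_mem_ball {n : ℕ} {x z : Fin n → Bool} {i : Fin n} (hz : z ∈ ball x)
    (hi : z i ≠ x i) : z = flip x i := by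
  rcases mem_ball.1 hz with rfl | ⟨j, rfl⟩
  · exact absurd rfl hi
  · by_cases hij : i = j
    · rw [hij]
    · exact absurd (flip_apply_of_ne x hij) hi

theorem isReg_ball (n : ℕ) : IsReg (ball (n := n)) (n + 1) where
  refl x := mem_ball.2 (Or.inl rfl)
  symm x y h := by
    rcases mem_ball.1 h with rfl | ⟨i, rfl⟩
    · exact h
    · exact mem_ball.2 (Or.inr ⟨i, flip_flip x i⟩)
  card x := by
    rw [ball, card_insert_of_notMem, card_image_of_injective _ (flip_injective x), card_univ,
      Fintype.card_fin]
    simp [flip_ne]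

theorem card_ball_inter_le {n : ℕ} {x y : Fin n → Bool} (h : x ≠ y) :
    (ball x ∩ ball y).card ≤ 2 := by
  obtain ⟨i, hi⟩ := Function.ne_iff.1 h
  refine (card_le_card (t := {flip x i, flip y i}) fun z hz => ?_).trans card_le_two
  rw [mem_inter] at hz
  rw [mem_insert, mem_singleton]
  by_cases hzx : z i = x i
  · exact Or.inr (eq_flip_of_mem_ball hz.2 (by rwa [hzx]))
  · exact Or.inl (eq_flip_of_mem_ball hz.1 hzx)

theorem card_le_of_two_mul_card_le {n r : ℕ} (hr : n ≤ r ^ 2) {X : Finset (Fin n → Bool)}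
    (hX : 2 * X.card ≤ 2 ^ n) : X.card ≤ 2 * r * ((nbhd ball X).card - X.card) := by
  have h1 := sum_sqrt_outDeg_ge n Xᶜ
  have hc : (Xᶜ.card : ℝ) = 2 ^ n - X.card := by
    rw [card_compl, Fintype.card_fun, Fintype.card_bool, Fintype.card_fin, Nat.cast_sub (by omega)]
    push_cast
    rfl
  have h2 : ∑ x ∈ Xᶜ, √(outDeg Xᶜ x) ≤ ∑ x ∈ nbhd ball X \ X, (r : ℝ) := by
    have h3 : ∑ x ∈ Xᶜ, √(outDeg Xᶜ x) = ∑ x ∈ nbhd ball X \ X, √(outDeg Xᶜ x) := by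
      symm
      refine sum_subset (fun x hx => mem_compl.2 (mem_sdiff.1 hx).2) fun x hx hx' => ?_
      have : outDeg Xᶜ x = 0 := by
        rw [outDeg, card_eq_zero, filter_eq_empty_iff]
        intro i _ hi
        rw [mem_compl, not_not] at hi
        exact hx' (mem_sdiff.2 ⟨mem_nbhd.2 ⟨_, hi, (isReg_ball n).symm _ _
          (mem_ball.2 (Or.inr ⟨i, rfl⟩))⟩, mem_compl.1 hx⟩)
      rw [this, Nat.cast_zero, Real.sqrt_zero]
    rw [h3]
    refine sum_le_sum fun x _ => Real.sqrt_le_iff.2 ⟨by positivity, ?_⟩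
    have : outDeg Xᶜ x ≤ n := (card_le_univ _).trans (by simp)
    exact_mod_cast this.trans hr
  rw [sum_const, nsmul_eq_mul, card_sdiff_of_subset ((isReg_ball n).subset_nbhd X)] at h2
  have h4 := h1.trans h2
  rw [hc, div_le_iff₀ (by positivity)] at h4
  have hX' : 2 * (X.card : ℝ) ≤ 2 ^ n := by exact_mod_cast hX
  set t := (nbhd ball X).card - X.card
  have h5 : (X.card : ℝ) * 2 ^ n ≤ (2 * r * t) * 2 ^ n := by
    have : (X.card : ℝ) * 2 ^ n ≤ X.card * (2 * (2 ^ n - X.card)) := by gcongr; linarith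
    nlinarith
  have h6 := le_of_mul_le_mul_right h5 (by positivity)
  exact_mod_cast h6

theorem expanding_ball {n l : ℕ} (hl : ScaleFor l (n + 1)) :
    Expanding (ball (n := n)) l (n + 1) where
  reg := isReg_ball n
  scale := hl
  pair _ _ h := card_ball_inter_le h
  iso X hX := by
    have h1 := card_le_of_two_mul_card_le (n := n) (r := 2 ^ (4 * l + 4)) (X := X) (by
      have h2 := hl.upper
      rw [← pow_mul, show (4 * l + 4) * 2 = 8 * l + 8 by ring]
      omega) (by simpa using hX)
    refine h1.trans_eq ?_
    rw [pow_add, mul_comm 4 l, pow_mul]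
    ring
  card := by simp [pow_succ, mul_comm]

theorem exists_scaleFor : ∃ d₀ : ℕ, ∀ d, d₀ ≤ d → ∃ l, ScaleFor l d := by
  refine ⟨2 ^ 200, fun d hd => ⟨Nat.log 2 d / 8, ?_⟩⟩
  have hd0 : d ≠ 0 := by rintro rfl; norm_num at hd
  have h1 : 200 ≤ Nat.log 2 d := Nat.le_log_of_pow_le (by norm_num) hd
  refine ⟨?_, ?_, ?_⟩
  · exact (Nat.pow_le_pow_right (by norm_num) (by omega)).trans (Nat.pow_log_le_self 2 hd0)
  · exact (Nat.lt_pow_succ_log_self (by norm_num) d).le.trans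
      (Nat.pow_le_pow_right (by norm_num) (by omega))
  · have h2 : 25 ≤ Nat.log 2 d / 8 := by omega
    generalize Nat.log 2 d / 8 = l at h2
    induction l, h2 using Nat.le_induction with
    | base => norm_num
    | succ l _ ih => rw [pow_succ]; omega

/-- A height function on the two sides of a bipartite double cover: `g` on the even side and `h` on
the odd side. -/
structure IsPair {V : Type*} (nb : V → Finset V) (g h : V → ℤ) : Prop where
  even : ∀ x, Even (g x)
  odd : ∀ x, Odd (h x)
  adj : ∀ x, ∀ y ∈ nb x, |g x - h y| = 1

theorem IsPair.neg {nb : V → Finset V} {g h : V → ℤ} (hp : IsPair nb g h) : IsPair nb (-g) (-h) where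
  even x := (hp.even x).neg
  odd x := (hp.odd x).neg
  adj x y hy := by
    rw [Pi.neg_apply, Pi.neg_apply, ← abs_neg, ← hp.adj x y hy]
    congr 1; ring

/-- The superlevel sets of a height function, alternating between the two sides. -/
noncomputable def level (g h : V → ℤ) (j : ℕ) : Finset V :=
  univ.filter fun x => (j + 2 : ℤ) ≤ if Even j then g x else h x

/-- The points of the even side at height at least two. -/
noncomputable def upper (g : V → ℤ) : Finset V := univ.filter fun x => 2 ≤ g x

theorem mem_upper {g : V → ℤ} {x : V} : x ∈ upper g ↔ 2 ≤ g x := by simp [upper]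

theorem level_zero (g h : V → ℤ) : level g h 0 = upper g := by
  ext; simp [level, upper]

theorem nbhd_level_subset {nb : V → Finset V} (hsymm : ∀ x y, y ∈ nb x → x ∈ nb y) {g h : V → ℤ}
    (hp : IsPair nb g h) (j : ℕ) : nbhd nb (level g h (j + 1)) ⊆ level g h j := by
  intro y hy
  obtain ⟨x, hx, hxy⟩ := mem_nbhd.1 hy
  simp only [level, mem_filter, mem_univ, true_and, Nat.even_add_one] at hx ⊢
  push_cast at hx
  have h1 := hp.adj x y hxy
  have h2 := hp.adj y x (hsymm _ _ hxy)
  rw [abs_eq (by norm_num)] at h1 h2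
  split_ifs at * <;> omega

theorem card_seq_le (nb : V → Finset V) (m : ℕ) : ∀ (A : Finset V) (T : Finset (ℕ → Finset V)),
    (∀ s ∈ T, s 0 = A ∧ (∀ j, nbhd nb (s (j + 1)) ⊆ s j) ∧ ∀ j, m ≤ j → s j = ∅) →
    T.card ≤ Phi nb m A := by
  induction m with
  | zero =>
    intro A T hT
    rcases T.eq_empty_or_nonempty with rfl | ⟨s, hs⟩
    · simp
    · have hA : A = ∅ := by rw [← (hT s hs).1]; exact (hT s hs).2.2 0 le_rfl
      rw [Phi, if_pos hA, card_le_one]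
      intro a ha b hb
      funext j
      rw [(hT a ha).2.2 j (Nat.zero_le _), (hT b hb).2.2 j (Nat.zero_le _)]
  | succ m ih =>
    intro A T hT
    rw [Phi, card_eq_sum_card_fiberwise (f := fun s => s 1)
      (t := univ.filter fun B => nbhd nb B ⊆ A)]
    · refine sum_le_sum fun B _ => ?_
      rw [← card_image_of_injOn (f := fun (s : ℕ → Finset V) (j : ℕ) => s (j + 1))]
      · apply ih
        intro u hu
        obtain ⟨s, hs, rfl⟩ := mem_image.1 hu
        obtain ⟨hs, hB⟩ := mem_filter.1 hs
        exact ⟨hB, fun j => (hT s hs).2.1 _, fun j hj => (hT s hs).2.2 _ (by omega)⟩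
      · intro s hs s' hs' he
        have hs := (hT s (mem_filter.1 hs).1).1
        have hs' := (hT s' (mem_filter.1 hs').1).1
        funext j
        cases j with
        | zero => rw [hs, hs']
        | succ j => exact congrFun he j
    · intro s hs
      simp only [coe_filter, mem_univ, true_and, Set.mem_ofPred_eq]
      have := (hT s hs).2.1 0
      rwa [(hT s hs).1] at this

theorem le_iff_of_level_eq {g h g' h' : V → ℤ} (hl : level g h = level g' h') (c : ℕ) (hc : 2 ≤ c)
    (x : V) : (Even c → (c ≤ g x ↔ c ≤ g' x)) ∧ (Odd c → (c ≤ h x ↔ c ≤ h' x)) := by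
  obtain ⟨j, rfl⟩ := Nat.exists_eq_add_of_le' hc
  have := Finset.ext_iff.1 (congrFun hl j) x
  simp only [level, mem_filter, mem_univ, true_and] at this
  push_cast
  constructor <;> intro hj
  · have hj : Even j := by simpa [Nat.even_add] using hj
    simpa [hj] using this
  · have hj : ¬ Even j := by simpa [Nat.odd_add] using hj
    simpa [hj] using this

theorem pair_ext {nb : V → Finset V} {g h g' h' : V → ℤ} (hp : IsPair nb g h)
    (hp' : IsPair nb g' h') (hl : level g h = level g' h')
    (hl' : level (-g) (-h) = level (-g') (-h')) (hR : ∀ x, 1 ≤ h x ↔ 1 ≤ h' x) :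
    g = g' ∧ h = h' := by
  have key : ∀ a b : ℤ, (∀ c : ℕ, 1 ≤ c → c % 2 = a % 2 → c % 2 = b % 2 → (c ≤ a ↔ c ≤ b)) →
      (∀ c : ℕ, 2 ≤ c → c % 2 = a % 2 → c % 2 = b % 2 → (c ≤ -a ↔ c ≤ -b)) → a % 2 = b % 2 →
      a = b := by
    intro a b h1 h2 hab
    have h3 := h1 a.toNat
    have h4 := h1 b.toNat
    have h5 := h2 (-a).toNat
    have h6 := h2 (-b).toNat
    omega
  constructor
  · funext x
    have e1 := Int.even_iff.1 (hp.even x)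
    have e2 := Int.even_iff.1 (hp'.even x)
    refine key _ _ (fun c hc h1 _ => ?_) (fun c hc h1 _ => ?_) (by omega)
    · exact (le_iff_of_level_eq hl c (by omega) x).1 (Nat.even_iff.2 (by omega))
    · exact (le_iff_of_level_eq hl' c (by omega) x).1 (Nat.even_iff.2 (by omega))
  · funext x
    have e1 := Int.odd_iff.1 (hp.odd x)
    have e2 := Int.odd_iff.1 (hp'.odd x)
    refine key _ _ (fun c hc h1 _ => ?_) (fun c hc h1 _ => ?_) (by omega)
    · rcases hc.eq_or_lt with rfl | hc
      · exact_mod_cast hR x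
      · exact (le_iff_of_level_eq hl c (by omega) x).2 (Nat.odd_iff.2 (by omega))
    · exact (le_iff_of_level_eq hl' c (by omega) x).2 (Nat.odd_iff.2 (by omega))

theorem level_eq_empty {g h : V → ℤ} {m : ℕ} (hg : ∀ x, |g x| ≤ m) (hh : ∀ x, |h x| ≤ m) {j : ℕ}
    (hj : m ≤ j) : level g h j = ∅ := by
  rw [level, filter_eq_empty_iff]
  intro x _
  have h1 := (abs_le.1 (hg x)).2
  have h2 := (abs_le.1 (hh x)).2
  split_ifs <;> omega

namespace IsReg

variable {nb : V → Finset V} {d : ℕ}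

theorem card_pair_fiber_le (hr : IsReg nb d) (m : ℕ) (T : Finset ((V → ℤ) × (V → ℤ)))
    (A A' : Finset V) (hT : ∀ p ∈ T, IsPair nb p.1 p.2 ∧ (∀ x, |p.1 x| ≤ m) ∧ (∀ x, |p.2 x| ≤ m) ∧
      upper p.1 = A ∧ upper (-p.1) = A') :
    (T.card : ℝ) ≤ 2 ^ Fintype.card V * (wt nb m A * wt nb m A') := by
  rcases T.eq_empty_or_nonempty with rfl | ⟨p₀, hp₀⟩
  · simp only [card_empty, Nat.cast_zero]
    exact mul_nonneg (by positivity) (mul_nonneg (wt_nonneg _ _) (wt_nonneg _ _))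
  have hR : ∀ p ∈ T, nbhd nb A ⊆ univ.filter (fun x => 1 ≤ p.2 x) ∧
      univ.filter (fun x => 1 ≤ p.2 x) ⊆ (nbhd nb A')ᶜ := by
    intro p hp
    obtain ⟨h1, -, -, h4, h5⟩ := hT p hp
    constructor
    · intro y hy
      obtain ⟨x, hx, hxy⟩ := mem_nbhd.1 hy
      rw [← h4, mem_upper] at hx
      have := h1.adj x y hxy
      rw [abs_eq (by norm_num)] at this
      simp only [mem_filter, mem_univ, true_and]
      omega
    · intro y hy
      rw [mem_compl]
      intro hy'
      obtain ⟨x, hx, hxy⟩ := mem_nbhd.1 hy'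
      rw [← h5, mem_upper, Pi.neg_apply] at hx
      have := h1.adj x y hxy
      rw [abs_eq (by norm_num)] at this
      simp only [mem_filter, mem_univ, true_and] at hy
      omega
  have hdisj : nbhd nb A ⊆ (nbhd nb A')ᶜ := (hR p₀ hp₀).1.trans (hR p₀ hp₀).2
  have hinj : Set.InjOn (fun p : (V → ℤ) × (V → ℤ) =>
      ((level p.1 p.2, level (-p.1) (-p.2)), univ.filter fun x => 1 ≤ p.2 x)) T := by
    intro p hp p' hp' he
    simp only [Prod.mk.injEq] at he
    obtain ⟨⟨h1, h2⟩, h3⟩ := he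
    have := pair_ext (hT p hp).1 (hT p' hp').1 h1 h2 (fun x => by
      simpa using Finset.ext_iff.1 h3 x)
    exact Prod.ext this.1 this.2
  have hsub : T.image (fun p : (V → ℤ) × (V → ℤ) =>
      ((level p.1 p.2, level (-p.1) (-p.2)), univ.filter fun x => 1 ≤ p.2 x)) ⊆
      (T.image (fun p => level p.1 p.2) ×ˢ T.image (fun p => level (-p.1) (-p.2))) ×ˢ
        Icc (nbhd nb A) (nbhd nb A')ᶜ := by
    intro q hq
    obtain ⟨p, hp, rfl⟩ := mem_image.1 hq
    simp only [mem_product, mem_Icc]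
    exact ⟨⟨mem_image_of_mem _ hp, mem_image_of_mem _ hp⟩, hR p hp⟩
  have hc := card_le_card hsub
  rw [card_image_of_injOn hinj, card_product, card_product, card_Icc_finset hdisj,
    card_compl] at hc
  have h1 : (T.image fun p => level p.1 p.2).card ≤ Phi nb m A := by
    refine card_seq_le nb m A _ fun s hs => ?_
    obtain ⟨p, hp, rfl⟩ := mem_image.1 hs
    obtain ⟨h1, h2, h3, h4, h5⟩ := hT p hp
    exact ⟨(level_zero _ _).trans h4, nbhd_level_subset hr.symm h1, fun j => level_eq_empty h2 h3⟩
  have h2 : (T.image fun p => level (-p.1) (-p.2)).card ≤ Phi nb m A' := by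
    refine card_seq_le nb m A' _ fun s hs => ?_
    obtain ⟨p, hp, rfl⟩ := mem_image.1 hs
    obtain ⟨h1, h2, h3, h4, h5⟩ := hT p hp
    exact ⟨(level_zero _ _).trans h5, nbhd_level_subset hr.symm h1.neg,
      fun j => level_eq_empty (by simpa using h2) (by simpa using h3)⟩
  have h3 := card_le_card hdisj
  have h4 := card_le_univ (nbhd nb A')
  rw [card_compl] at h3
  have h5 : T.card ≤ Phi nb m A * Phi nb m A' *
      2 ^ (Fintype.card V - (nbhd nb A').card - (nbhd nb A).card) :=
    hc.trans (by gcongr)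
  have h6 : (2 : ℝ) ^ Fintype.card V =
      2 ^ (Fintype.card V - (nbhd nb A').card - (nbhd nb A).card) *
      (2 ^ (nbhd nb A).card * 2 ^ (nbhd nb A').card) := by
    rw [← pow_add, ← pow_add]
    congr 1
    omega
  calc (T.card : ℝ) ≤ ((Phi nb m A * Phi nb m A' *
      2 ^ (Fintype.card V - (nbhd nb A').card - (nbhd nb A).card) : ℕ) : ℝ) := by exact_mod_cast h5
    _ = _ := by
      rw [h6, wt, wt]
      push_cast
      field_simp

theorem card_pairs_le (hr : IsReg nb d) (m : ℕ) (T : Finset ((V → ℤ) × (V → ℤ)))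
    (P P' : Finset (Finset V)) (hT : ∀ p ∈ T, IsPair nb p.1 p.2 ∧ (∀ x, |p.1 x| ≤ m) ∧
      (∀ x, |p.2 x| ≤ m) ∧ upper p.1 ∈ P ∧ upper (-p.1) ∈ P') :
    (T.card : ℝ) ≤ 2 ^ Fintype.card V * ((∑ A ∈ P, wt nb m A) * ∑ A ∈ P', wt nb m A) := by
  rw [card_eq_sum_card_fiberwise (f := fun p => (upper p.1, upper (-p.1))) (t := P ×ˢ P')
    (fun p hp => by simpa using (hT p hp).2.2.2), sum_mul_sum, ← sum_product', mul_sum, Nat.cast_sum]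
  refine sum_le_sum fun q _ => hr.card_pair_fiber_le m _ _ _ fun p hp => ?_
  obtain ⟨hp, he⟩ := mem_filter.1 hp
  obtain ⟨h1, h2, h3, -⟩ := hT p hp
  exact ⟨h1, h2, h3, congrArg Prod.fst he, congrArg Prod.snd he⟩

end IsReg

/-- Subtract `k` from a height function, exchanging the two sides if `k` is odd. -/
noncomputable def shift {V : Type*} (k : ℤ) (p : (V → ℤ) × (V → ℤ)) : (V → ℤ) × (V → ℤ) :=
  if Even k then (fun x => p.1 x - k, fun x => p.2 x - k)
  else (fun x => p.2 x - k, fun x => p.1 x - k)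

theorem shift_injective {V : Type*} (k : ℤ) : Function.Injective (shift (V := V) k) := by
  rintro ⟨g, h⟩ ⟨g', h'⟩ he
  unfold shift at he
  split_ifs at he <;> simp only [Prod.mk.injEq, funext_iff, sub_left_inj] at he <;>
    simp only [Prod.mk.injEq, funext_iff] <;> tauto

theorem shift_pred_fst {V : Type*} (k : ℤ) (p : (V → ℤ) × (V → ℤ)) (x : V) :
    (shift (k - 1) p).1 x = (shift k p).2 x + 1 := by
  unfold shift
  by_cases hk : Even k
  · rw [if_pos hk, if_neg (by simpa [Int.even_sub_one] using hk)]
    simp only; ring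
  · rw [if_neg hk, if_pos (by simpa [Int.even_sub_one] using hk)]
    simp only; ring

theorem IsPair.shift {nb : V → Finset V} {d : ℕ} (hr : IsReg nb d) {p : (V → ℤ) × (V → ℤ)}
    (hp : IsPair nb p.1 p.2) (k : ℤ) : IsPair nb (shift k p).1 (shift k p).2 := by
  unfold CubeHom.shift
  split_ifs with hk
  · exact ⟨fun x => (hp.even x).sub hk, fun x => (hp.odd x).sub_even hk,
      fun x y hy => by simpa using hp.adj x y hy⟩
  · rw [Int.not_even_iff_odd] at hk
    exact ⟨fun x => (hp.odd x).sub_odd hk, fun x => (hp.even x).sub_odd hk,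
      fun x y hy => by simpa [abs_sub_comm] using hp.adj y x (hr.symm _ _ hy)⟩

theorem abs_shift_le {V : Type*} {p : (V → ℤ) × (V → ℤ)} {M : ℕ}
    (hp : ∀ x, |p.1 x| ≤ M ∧ |p.2 x| ≤ M) {k : ℤ} (hk : k ∈ Icc (-M - 2 : ℤ) M) (x : V) :
    |(shift k p).1 x| ≤ (2 * M + 2 : ℕ) ∧ |(shift k p).2 x| ≤ (2 * M + 2 : ℕ) := by
  rw [mem_Icc] at hk
  have h := hp x
  simp only [abs_le] at h ⊢
  unfold shift
  push_cast
  split_ifs <;> simp only <;> omega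

theorem exists_step (P : ℤ → Prop) (a : ℤ) (n : ℕ) (h0 : ¬ P a) (h1 : P (a + n)) :
    ∃ k, a < k ∧ k ≤ a + n ∧ P k ∧ ¬ P (k - 1) := by
  induction n with
  | zero => exact absurd (by simpa using h1) h0
  | succ n ih =>
    by_cases h : P (a + n)
    · obtain ⟨k, h2, h3, h4⟩ := ih h
      exact ⟨k, h2, by push_cast; omega, h4⟩
    · refine ⟨a + (n + 1 : ℕ), by push_cast; omega, le_rfl, h1, ?_⟩
      rwa [show a + (n + 1 : ℕ) - 1 = a + n by push_cast; ring]

namespace IsReg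

variable {nb : V → Finset V} {d : ℕ}

theorem exists_shift (hr : IsReg nb d) [Nonempty V] {p : (V → ℤ) × (V → ℤ)}
    (hp : IsPair nb p.1 p.2) {M : ℕ} (hM : ∀ x, |p.1 x| ≤ M ∧ |p.2 x| ≤ M) :
    ∃ k ∈ Icc (-M - 2 : ℤ) M, Small nb (upper (shift k p).1) ∧
      Small nb (upper (-(shift k p).1)) := by
  have h0 : ¬ Small nb (upper (shift (-M - 2 : ℤ) p).1) := by
    have h1 : upper (shift (-M - 2 : ℤ) p).1 = univ := by
      rw [eq_univ_iff_forall]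
      intro x
      rw [mem_upper]
      have h := hM x
      simp only [abs_le] at h
      unfold shift
      split_ifs <;> simp only <;> omega
    have h2 : core nb (nbhd nb (upper (shift (-M - 2 : ℤ) p).1)) = univ := by
      rw [h1, eq_univ_iff_forall]
      exact fun x => subset_core_nbhd nb univ (mem_univ x)
    have := Fintype.card_pos (α := V)
    rw [Small, h2, card_univ]
    omega
  have h1 : Small nb (upper (shift (-M - 2 + (2 * M + 2 : ℕ) : ℤ) p).1) := by
    have h1 : upper (shift (-M - 2 + (2 * M + 2 : ℕ) : ℤ) p).1 = ∅ := by
      rw [eq_empty_iff_forall_notMem]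
      intro x
      rw [mem_upper]
      have h := hM x
      simp only [abs_le] at h
      unfold shift
      push_cast
      split_ifs <;> simp only <;> omega
    have h2 : core nb (nbhd nb (upper (shift (-M - 2 + (2 * M + 2 : ℕ) : ℤ) p).1)) = ∅ := by
      rw [h1, ← subset_empty]
      exact (hr.core_subset _).trans (by simp [nbhd])
    rw [Small, h2]
    simp
  obtain ⟨k, h2, h3, h4, h5⟩ := exists_step (fun k => Small nb (upper (shift k p).1)) _ _ h0 h1
  refine ⟨k, mem_Icc.2 ⟨h2.le, by push_cast at h3; omega⟩, h4, ?_⟩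
  have hs := hp.shift hr k
  have hd : Disjoint (core nb (nbhd nb (upper (-(shift k p).1))))
      (core nb (nbhd nb (upper (shift (k - 1) p).1))) := by
    rw [disjoint_left]
    intro x hx hx'
    obtain ⟨u, hu, hxu⟩ := mem_nbhd.1 (hr.core_subset _ hx')
    obtain ⟨y, hy, huy⟩ := mem_nbhd.1 (mem_core.1 hx (hr.symm _ _ hxu))
    rw [mem_upper, shift_pred_fst] at hu
    rw [mem_upper, Pi.neg_apply] at hy
    have := hs.adj y u huy
    rw [abs_eq (by norm_num)] at this
    omega
  have hc := card_le_univ (core nb (nbhd nb (upper (-(shift k p).1))) ∪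
      (core nb (nbhd nb (upper (shift (k - 1) p).1))))
  rw [card_union_of_disjoint hd] at hc
  unfold Small at *
  omega

end IsReg

/-- The normalised height functions bounded by `M`. -/
structure Normal (nb : V → Finset V) (v : V) (M : ℕ) (p : (V → ℤ) × (V → ℤ)) : Prop where
  pair : IsPair nb p.1 p.2
  base : p.1 v = 0
  bound : ∀ x, |p.1 x| ≤ M ∧ |p.2 x| ≤ M

/-- The total weight of the small sets with the property `P`. -/
noncomputable def total (nb : V → Finset V) (m : ℕ) (P : Finset V → Prop) : ℝ :=
  ∑ A ∈ univ.filter (fun A => Small nb A ∧ P A), wt nb m A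

theorem total_nonneg (nb : V → Finset V) (m : ℕ) (P : Finset V → Prop) : 0 ≤ total nb m P :=
  sum_nonneg fun _ _ => IsReg.wt_nonneg _ _

namespace Expanding

variable {nb : V → Finset V} {l d : ℕ}

theorem card_shift_le (h : Expanding nb l d) {v : V} {M : ℕ}
    (S : Finset ((V → ℤ) × (V → ℤ))) {k : ℤ} (hk : k ∈ Icc (-M - 2 : ℤ) M) (P P' : Finset V → Prop)
    (hS : ∀ p ∈ S, Normal nb v M p ∧ (Small nb (upper (shift k p).1) ∧ P (upper (shift k p).1)) ∧
      (Small nb (upper (-(shift k p).1)) ∧ P' (upper (-(shift k p).1)))) :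
    (S.card : ℝ) ≤ 2 ^ Fintype.card V *
      (total nb (2 * M + 2) P * total nb (2 * M + 2) P') := by
  rw [← card_image_of_injective S (shift_injective k)]
  refine h.reg.card_pairs_le _ _ _ _ fun q hq => ?_
  obtain ⟨p, hp, rfl⟩ := mem_image.1 hq
  obtain ⟨h1, h2, h3⟩ := hS p hp
  refine ⟨h1.pair.shift h.reg k, fun x => (abs_shift_le h1.bound hk x).1,
    fun x => (abs_shift_le h1.bound hk x).2, ?_, ?_⟩
  · exact mem_filter.2 ⟨mem_univ _, h2⟩
  · exact mem_filter.2 ⟨mem_univ _, h3⟩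

theorem total_true_le (h : Expanding nb l d) (m : ℕ) : total nb m (fun _ => True) ≤ 8 :=
  (le_of_eq (by unfold total; congr! 2; simp)).trans (h.sum_wt_le m)

theorem total_mem_le (h : Expanding nb l d) (m : ℕ) (v : V) :
    total nb m (fun A => v ∈ A) ≤ 32 / 2 ^ d :=
  (le_of_eq (by unfold total; congr!)).trans (h.sum_wt_mem_le m v)

theorem total_ball_le (h : Expanding nb l d) (m : ℕ) (v : V) :
    total nb m (fun A => nb v ⊆ A) ≤ 8 / 2 ^ (3 * d) :=
  (le_of_eq (by unfold total; congr!)).trans (h.sum_wt_ball_le m v)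

theorem card_shift_le_const (h : Expanding nb l d) {v : V} {M : ℕ}
    (S : Finset ((V → ℤ) × (V → ℤ))) {k : ℤ} (hk : k ∈ Icc (-M - 2 : ℤ) M)
    (hS : ∀ p ∈ S, Normal nb v M p ∧ Small nb (upper (shift k p).1) ∧
      Small nb (upper (-(shift k p).1))) :
    (S.card : ℝ) ≤ 2 ^ Fintype.card V * 64 := by
  refine (h.card_shift_le S hk (v := v) (fun _ => True) (fun _ => True) (fun p hp => by
    simpa using hS p hp)).trans ?_
  have h1 := h.total_true_le (2 * M + 2)
  have h2 := total_nonneg nb (2 * M + 2) (fun _ => True)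
  gcongr
  calc _ ≤ (8 : ℝ) * 8 := by gcongr
    _ = 64 := by norm_num

theorem card_shift_le_of_two_le (h : Expanding nb l d) {v : V} {M : ℕ}
    (S : Finset ((V → ℤ) × (V → ℤ))) {k : ℤ} (hk : k ∈ Icc (-M - 2 : ℤ) M) (hk2 : 2 ≤ |k|)
    (hS : ∀ p ∈ S, Normal nb v M p ∧ Small nb (upper (shift k p).1) ∧
      Small nb (upper (-(shift k p).1))) :
    (S.card : ℝ) ≤ 2 ^ Fintype.card V * (256 / 2 ^ d) := by
  have h1 := h.total_true_le (2 * M + 2)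
  have h2 := total_nonneg nb (2 * M + 2) (fun _ => True)
  have h3 := h.total_mem_le (2 * M + 2) v
  have h4 := total_nonneg nb (2 * M + 2) (fun A => v ∈ A)
  have hb : ∀ p ∈ S, (p.2 v = 1 ∨ p.2 v = -1) ∧ p.1 v = 0 := by
    intro p hp
    have h5 := (hS p hp).1
    have h6 := h5.pair.adj v v (h.reg.refl v)
    rw [h5.base, abs_eq (by norm_num)] at h6
    exact ⟨by omega, h5.base⟩
  have h256 : (256 : ℝ) / 2 ^ d = 8 * (32 / 2 ^ d) := by ring
  rw [le_abs] at hk2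
  rcases hk2 with hk2 | hk2
  · refine (h.card_shift_le S hk (v := v) (fun _ => True) (fun A => v ∈ A) (fun p hp => ?_)).trans ?_
    · obtain ⟨h5, h6, h7⟩ := hS p hp
      refine ⟨h5, ⟨h6, trivial⟩, h7, ?_⟩
      rw [mem_upper, Pi.neg_apply]
      have := hb p hp
      unfold shift
      split_ifs with hk'
      · simp only; omega
      · have : k ≠ 2 := by rintro rfl; exact hk' even_two
        simp only; omega
    · rw [h256]
      gcongr
  · refine (h.card_shift_le S hk (v := v) (fun A => v ∈ A) (fun _ => True) (fun p hp => ?_)).trans ?_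
    · obtain ⟨h5, h6, h7⟩ := hS p hp
      refine ⟨h5, ⟨h6, ?_⟩, h7, trivial⟩
      rw [mem_upper]
      have := hb p hp
      unfold shift
      split_ifs with hk'
      · simp only; omega
      · have : k ≠ -2 := by rintro rfl; exact hk' (by decide)
        simp only; omega
    · rw [h256, mul_comm (8 : ℝ)]
      gcongr

theorem card_shift_le_of_ball (h : Expanding nb l d) {v : V} {M : ℕ}
    (S : Finset ((V → ℤ) × (V → ℤ))) {k : ℤ} (hk : k ∈ Icc (-M - 2 : ℤ) M) (y : V)
    (hS : ∀ p ∈ S, Normal nb v M p ∧ Small nb (upper (shift k p).1) ∧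
      Small nb (upper (-(shift k p).1)) ∧
      (nb y ⊆ upper (shift k p).1 ∨ nb y ⊆ upper (-(shift k p).1))) :
    (S.card : ℝ) ≤ 2 ^ Fintype.card V * (128 / 2 ^ (3 * d)) := by
  have h1 := h.total_true_le (2 * M + 2)
  have h2 := total_nonneg nb (2 * M + 2) (fun _ => True)
  have h3 := h.total_ball_le (2 * M + 2) y
  have h4 := total_nonneg nb (2 * M + 2) (fun A => nb y ⊆ A)
  have h5 := h.card_shift_le (S.filter fun p => nb y ⊆ upper (shift k p).1) hk (v := v)
    (fun A => nb y ⊆ A) (fun _ => True) (fun p hp => by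
      obtain ⟨hp, hy⟩ := mem_filter.1 hp
      have := hS p hp
      tauto)
  have h6 := h.card_shift_le (S.filter fun p => ¬ nb y ⊆ upper (shift k p).1) hk (v := v)
    (fun _ => True) (fun A => nb y ⊆ A) (fun p hp => by
      obtain ⟨hp, hy⟩ := mem_filter.1 hp
      have := hS p hp
      tauto)
  rw [← card_filter_add_card_filter_not (s := S) (fun p => nb y ⊆ upper (shift k p).1),
    Nat.cast_add]
  have h128 : (2 : ℝ) ^ Fintype.card V * (128 / 2 ^ (3 * d)) =
      2 ^ Fintype.card V * (8 / 2 ^ (3 * d) * 8) + 2 ^ Fintype.card V * (8 * (8 / 2 ^ (3 * d))) := by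
    ring
  rw [h128]
  refine add_le_add (h5.trans ?_) (h6.trans ?_) <;> gcongr

theorem poly_le (h : Expanding nb l d) : 512 * (2 * d + 3) ≤ 2 ^ d := by
  have h1 := h.scale.pow_le
  have h2 := h.scale.le_degree
  have h3 : 2 ^ (d / 2) ≤ 2 ^ d := Nat.pow_le_pow_right (by norm_num) (by omega)
  have h4 : 4 ≤ (d ^ 2 + 1) ^ 2 := by nlinarith
  have h5 : 288 * d * 4 ≤ 288 * d * (d ^ 2 + 1) ^ 2 := by gcongr
  omega

theorem card_normal_le (h : Expanding nb l d) {v : V} (S : Finset ((V → ℤ) × (V → ℤ)))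
    (hS : ∀ p ∈ S, Normal nb v d p) : (S.card : ℝ) ≤ 2 ^ Fintype.card V * 200 := by
  have : Nonempty V := ⟨v⟩
  have hsub : S ⊆ (Icc (-d - 2 : ℤ) d).biUnion fun k => S.filter fun p =>
      Small nb (upper (shift k p).1) ∧ Small nb (upper (-(shift k p).1)) := by
    intro p hp
    obtain ⟨k, hk, hk'⟩ := h.reg.exists_shift (hS p hp).pair (hS p hp).bound
    exact mem_biUnion.2 ⟨k, hk, mem_filter.2 ⟨hp, hk'⟩⟩
  have h1 : (S.card : ℝ) ≤ ∑ k ∈ Icc (-d - 2 : ℤ) d, ((S.filter fun p =>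
      Small nb (upper (shift k p).1) ∧ Small nb (upper (-(shift k p).1))).card : ℝ) := by
    exact_mod_cast (card_le_card hsub).trans card_biUnion_le
  have h2 : ∀ k ∈ Icc (-d - 2 : ℤ) d, ((S.filter fun p =>
      Small nb (upper (shift k p).1) ∧ Small nb (upper (-(shift k p).1))).card : ℝ) ≤
      2 ^ Fintype.card V * ((if k ∈ Icc (-1 : ℤ) 1 then 64 else 0) + 256 / 2 ^ d) := by
    intro k hk
    split_ifs with hk1
    · refine (h.card_shift_le_const _ hk fun p hp => ⟨hS p (mem_filter.1 hp).1,
        (mem_filter.1 hp).2⟩).trans ?_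
      gcongr
      exact le_add_of_nonneg_right (by positivity)
    · rw [zero_add]
      refine h.card_shift_le_of_two_le _ hk ?_ fun p hp => ⟨hS p (mem_filter.1 hp).1,
        (mem_filter.1 hp).2⟩
      rw [mem_Icc] at hk1
      rw [le_abs]
      omega
  refine (h1.trans (sum_le_sum h2)).trans ?_
  rw [← mul_sum, sum_add_distrib, sum_const, Int.card_Icc, ← sum_filter]
  gcongr
  have h3 : ∑ k ∈ (Icc (-d - 2 : ℤ) d).filter (fun k => k ∈ Icc (-1 : ℤ) 1), (64 : ℝ) ≤ 192 := by
    rw [sum_const, nsmul_eq_mul]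
    have : ((Icc (-d - 2 : ℤ) d).filter (fun k => k ∈ Icc (-1 : ℤ) 1)).card ≤ 3 :=
      (card_le_card (t := Icc (-1 : ℤ) 1) fun k hk => (mem_filter.1 hk).2).trans (by simp)
    have : ((((Icc (-d - 2 : ℤ) d).filter (fun k => k ∈ Icc (-1 : ℤ) 1)).card : ℕ) : ℝ) ≤ 3 := by
      exact_mod_cast this
    linarith
  have h4 : ((d : ℤ) + 1 - (-d - 2)).toNat = 2 * d + 3 := by omega
  have h5 : (512 * (2 * d + 3) : ℝ) ≤ 2 ^ d := by exact_mod_cast h.poly_le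
  have h6 : (2 * d + 3 : ℝ) * (256 / 2 ^ d) ≤ 8 := by
    rw [← mul_div_assoc, div_le_iff₀ (by positivity)]
    linarith
  rw [h4, nsmul_eq_mul]
  push_cast
  linarith

theorem card_steep_le (h : Expanding nb l d) {v : V} (S : Finset ((V → ℤ) × (V → ℤ)))
    (hS : ∀ p ∈ S, Normal nb v d p ∧ ∀ k : ℤ, ∃ x, 3 ≤ |p.1 x - k| ∨ 3 ≤ |p.2 x - k|) :
    (S.card : ℝ) ≤ 2 ^ Fintype.card V / (8 * 2 ^ d) := by
  have : Nonempty V := ⟨v⟩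
  have hsub : S ⊆ (Icc (-d - 2 : ℤ) d ×ˢ univ).biUnion fun k => S.filter fun p =>
      Small nb (upper (shift k.1 p).1) ∧ Small nb (upper (-(shift k.1 p).1)) ∧
      (nb k.2 ⊆ upper (shift k.1 p).1 ∨ nb k.2 ⊆ upper (-(shift k.1 p).1)) := by
    intro p hp
    obtain ⟨h1, h2⟩ := hS p hp
    obtain ⟨k, hk, hk', hk''⟩ := h.reg.exists_shift h1.pair h1.bound
    have hs := h1.pair.shift h.reg k
    suffices ∃ y, nb y ⊆ upper (shift k p).1 ∨ nb y ⊆ upper (-(shift k p).1) by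
      obtain ⟨y, hy⟩ := this
      exact mem_biUnion.2 ⟨(k, y), by simpa using hk, mem_filter.2 ⟨hp, hk', hk'', hy⟩⟩
    have h3 : ∃ y, 3 ≤ (shift k p).2 y ∨ (shift k p).2 y ≤ -3 := by
      have h4 : ∃ x, 3 ≤ |(shift k p).1 x| ∨ 3 ≤ |(shift k p).2 x| := by
        obtain ⟨x, hx⟩ := h2 k
        refine ⟨x, ?_⟩
        unfold shift
        split_ifs <;> simp only <;> tauto
      obtain ⟨x, hx⟩ := h4
      have h5 := hs.adj x x (h.reg.refl x)
      obtain ⟨a, ha⟩ := hs.even x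
      rw [abs_eq (by norm_num)] at h5
      simp only [le_abs] at hx
      exact ⟨x, by omega⟩
    obtain ⟨y, hy⟩ := h3
    refine ⟨y, hy.imp (fun hy z hz => ?_) (fun hy z hz => ?_)⟩ <;>
    · have h5 := hs.adj z y (h.reg.symm _ _ hz)
      rw [abs_eq (by norm_num)] at h5
      rw [mem_upper]
      try rw [Pi.neg_apply]
      omega
  have h1 : (S.card : ℝ) ≤ ∑ k ∈ Icc (-d - 2 : ℤ) d ×ˢ (univ : Finset V),
      ((2 : ℝ) ^ Fintype.card V * (128 / 2 ^ (3 * d))) := by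
    have h0 := (Nat.cast_le (α := ℝ)).2 ((card_le_card hsub).trans card_biUnion_le)
    rw [Nat.cast_sum] at h0
    refine h0.trans (sum_le_sum fun k hk => ?_)
    refine h.card_shift_le_of_ball _ (mem_product.1 hk).1 k.2 (v := v) fun p hp => ?_
    exact ⟨(hS p (mem_filter.1 hp).1).1, (mem_filter.1 hp).2⟩
  have h4 : ((d : ℤ) + 1 - (-d - 2)).toNat = 2 * d + 3 := by omega
  rw [sum_const, card_product, Int.card_Icc, h4, card_univ, nsmul_eq_mul] at h1
  have h5 : (512 * (2 * d + 3) : ℝ) ≤ 2 ^ d := by exact_mod_cast h.poly_le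
  have h6 : 2 * (Fintype.card V : ℝ) = 2 ^ d := by exact_mod_cast h.card
  refine h1.trans ?_
  push_cast
  rw [mul_comm 3 d, pow_mul, ← mul_div_assoc, ← mul_div_assoc, div_le_div_iff₀ (by positivity)
    (by positivity)]
  set D : ℝ := 2 ^ d
  set E : ℝ := 2 ^ Fintype.card V
  have hD : 0 < D := by positivity
  have hE : 0 < E := by positivity
  have h7 : (Fintype.card V : ℝ) = D / 2 := by linarith
  rw [h7]
  calc (2 * (d : ℝ) + 3) * (D / 2) * (E * 128) * (8 * D) =
      (512 * (2 * (d : ℝ) + 3)) * (E * D ^ 2) := by ring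
    _ ≤ D * (E * D ^ 2) := by gcongr
    _ = E * D ^ 3 := by ring

end Expanding

/-- The height function with a single peak at `x`, a single pit at `x'`, and the value `1` on the
odd side on `R`, away from the peak and the pit. -/
noncomputable def peakPit (nb : V → Finset V) (x x' : V) (R : Finset V) : (V → ℤ) × (V → ℤ) :=
  (fun z => if z = x then 2 else if z = x' then -2 else 0,
    fun y => if y ∈ nb x then 1 else if y ∈ nb x' then -1 else if y ∈ R then 1 else -1)

namespace IsReg

variable {nb : V → Finset V} {d : ℕ}

theorem isPair_peakPit (_hr : IsReg nb d) {x x' : V} (h : ¬ Near nb x x') (R : Finset V) :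
    IsPair nb (peakPit nb x x' R).1 (peakPit nb x x' R).2 where
  even z := by
    simp only [peakPit]
    split_ifs <;> decide
  odd z := by
    simp only [peakPit]
    split_ifs <;> decide
  adj z y hy := by
    rw [Near, not_not, disjoint_left] at h
    have := @h y
    simp only [peakPit]
    split_ifs <;> simp_all

theorem peakPit_injective (hr : IsReg nb d) {x y x' y' : V} {R R' : Finset V}
    (hx : ¬ Near nb x x') (hy : ¬ Near nb y y') (hR : R ⊆ univ \ (nb x ∪ nb x'))
    (hR' : R' ⊆ univ \ (nb y ∪ nb y')) (h : peakPit nb x x' R = peakPit nb y y' R') :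
    x = y ∧ x' = y' ∧ R = R' := by
  have hne : ∀ {a b}, ¬ Near nb a b → a ≠ b := by
    rintro a b hab rfl
    rw [Near, not_not, disjoint_left] at hab
    exact hab (hr.refl a) (hr.refl a)
  have hx1 := hne hx
  have hy1 := hne hy
  simp only [peakPit, Prod.mk.injEq, funext_iff] at h
  obtain ⟨h1, h2⟩ := h
  have e1 : x = y := by
    have := h1 x
    by_contra hxy
    simp only [if_true, if_neg hxy] at this
    split_ifs at this; omega
  have e2 : x' = y' := by
    have := h1 x'
    by_contra hxy
    rw [if_neg hx1.symm, if_pos rfl, if_neg hxy] at this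
    split_ifs at this
  subst e1 e2
  refine ⟨rfl, rfl, ?_⟩
  ext z
  have h3 := h2 z
  have h4 := @hR z
  have h5 := @hR' z
  simp only [mem_sdiff, mem_univ, true_and, mem_union] at h4 h5
  split_ifs at h3 <;> simp_all

end IsReg

namespace Expanding

variable {nb : V → Finset V} {l d : ℕ}

theorem card_five_ge (h : Expanding nb l d) {v : V} (S : Finset ((V → ℤ) × (V → ℤ)))
    (hS : ∀ p, Normal nb v 2 p → (∃ x, p.1 x = 2) → (∃ x, p.1 x = -2) → p ∈ S) :
    (2 : ℝ) ^ Fintype.card V / 8 ≤ S.card := by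
  set N := Fintype.card V with hN
  have hN2 : 2 * N = 2 ^ d := h.card
  have hd := h.scale.le_degree
  have hNd : 4 * (d ^ 2 + 1) ≤ N := by
    have h1 := h.scale.pow_le
    have h3 : 2 ^ (d / 2) ≤ 2 ^ d := Nat.pow_le_pow_right (by norm_num) (by omega)
    have h4 : 8 * (d ^ 2 + 1) ≤ 288 * d * (d ^ 2 + 1) ^ 2 := by
      rw [pow_two (d ^ 2 + 1), ← mul_assoc]
      gcongr
      nlinarith
    omega
  have h2d : 2 * d ≤ N := by nlinarith
  let I : Finset (Σ _ : V, Σ _ : V, Finset V) := (univ.erase v).sigma fun x =>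
    ((univ.erase v).filter fun x' => ¬ Near nb x x').sigma fun x' =>
      (univ \ (nb x ∪ nb x')).powerset
  have hI : (N - 1) * ((N - 1 - d ^ 2) * 2 ^ (N - 2 * d)) ≤ I.card := by
    rw [card_sigma]
    have h1 : ∀ x ∈ univ.erase v, (N - 1 - d ^ 2) * 2 ^ (N - 2 * d) ≤
        (((univ.erase v).filter fun x' => ¬ Near nb x x').sigma fun x' =>
          (univ \ (nb x ∪ nb x')).powerset).card := by
      intro x _
      rw [card_sigma]
      have h2 : ∀ x' ∈ (univ.erase v).filter fun x' => ¬ Near nb x x',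
          2 ^ (N - 2 * d) ≤ (univ \ (nb x ∪ nb x')).powerset.card := by
        intro x' hx'
        rw [card_powerset, card_sdiff_of_subset (subset_univ _), card_univ]
        have h3 := card_union_le (nb x) (nb x')
        rw [h.reg.card, h.reg.card] at h3
        exact Nat.pow_le_pow_right (by norm_num) (by omega)
      refine le_trans ?_ (card_nsmul_le_sum _ _ _ h2)
      rw [smul_eq_mul]
      gcongr
      have h4 := card_filter_add_card_filter_not (s := univ.erase v) (fun x' => Near nb x x')
      have h5 : ((univ.erase v).filter fun x' => Near nb x x').card ≤ d ^ 2 :=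
        (card_le_card (filter_subset_filter _ (subset_univ _))).trans (by
          convert h.reg.card_near_le x)
      rw [card_erase_of_mem (mem_univ v), card_univ] at h4
      omega
    refine le_trans ?_ (card_nsmul_le_sum _ _ _ h1)
    rw [card_erase_of_mem (mem_univ v), card_univ, smul_eq_mul]
  have hIS : I.card ≤ S.card := by
    refine card_le_card_of_injOn (fun q => peakPit nb q.1 q.2.1 q.2.2) ?_ ?_
    · rintro ⟨x, x', R⟩ hq
      simp only [I, coe_sigma, Set.mem_sigma_iff, mem_coe, mem_filter, mem_erase,
        mem_powerset, mem_univ, and_true] at hq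
      obtain ⟨hx, ⟨hx', hn⟩, hR⟩ := hq
      have hne : x' ≠ x := by
        rintro rfl
        rw [Near, not_not, disjoint_left] at hn
        exact hn (h.reg.refl _) (h.reg.refl _)
      refine hS _ ⟨h.reg.isPair_peakPit hn R, ?_, fun z => ?_⟩ ⟨x, ?_⟩ ⟨x', ?_⟩
      · simp [peakPit, hx.symm, hx'.symm]
      · simp only [peakPit]
        split_ifs <;> simp
      · simp [peakPit]
      · simp [peakPit, hne]
    · rintro ⟨x, x', R⟩ hq ⟨y, y', R'⟩ hq' he
      simp only [I, coe_sigma, Set.mem_sigma_iff, mem_coe, mem_filter, mem_erase,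
        mem_powerset, mem_univ, and_true] at hq hq'
      obtain ⟨rfl, rfl, rfl⟩ := h.reg.peakPit_injective hq.2.1.2 hq'.2.1.2 hq.2.2 hq'.2.2 he
      rfl
  have h1 : (((N - 1) * ((N - 1 - d ^ 2) * 2 ^ (N - 2 * d)) : ℕ) : ℝ) ≤ S.card := by
    exact_mod_cast hI.trans hIS
  refine le_trans ?_ h1
  have h2 : (2 : ℝ) ^ N = 2 ^ (N - 2 * d) * (2 * N) ^ 2 := by
    have : (2 * N : ℝ) = 2 ^ d := by exact_mod_cast hN2
    rw [this, ← pow_mul, ← pow_add]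
    congr 1
    omega
  have h3 : (3 : ℝ) * N ≤ 4 * ((N - 1 : ℕ) : ℝ) := by
    have : 3 * N ≤ 4 * (N - 1) := by omega
    exact_mod_cast this
  have h4 : (3 : ℝ) * N ≤ 4 * ((N - 1 - d ^ 2 : ℕ) : ℝ) := by
    have : 3 * N ≤ 4 * (N - 1 - d ^ 2) := by omega
    exact_mod_cast this
  rw [h2]
  push_cast only [Nat.cast_mul, Nat.cast_pow]
  set a := ((N - 1 : ℕ) : ℝ)
  set b := ((N - 1 - d ^ 2 : ℕ) : ℝ)
  set E : ℝ := 2 ^ (N - 2 * d)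
  have hE : 0 < E := by positivity
  have h5 : (3 : ℝ) * N * (3 * N) ≤ 4 * a * (4 * b) := by gcongr
  have h6 : (N : ℝ) ^ 2 / 2 ≤ a * b := by nlinarith
  calc E * (2 * N) ^ 2 / 8 = N ^ 2 / 2 * E := by ring
    _ ≤ a * b * E := by gcongr
    _ = a * (b * E) := by ring

end Expanding

end

theorem cubeAdj_flip {n : ℕ} (u : Fin n → Bool) (i : Fin n) : cubeAdj n u (flip u i) := by
  rw [cubeAdj, card_eq_one]
  refine ⟨i, ?_⟩
  ext j
  simp only [mem_filter, mem_univ, true_and, mem_singleton]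
  by_cases h : j = i
  · subst h; simp [flip_apply_self]
  · simp [flip_apply_of_ne _ h, h]

theorem exists_eq_flip {n : ℕ} {u v : Fin n → Bool} (h : cubeAdj n u v) : ∃ i, v = flip u i := by
  rw [cubeAdj, card_eq_one] at h
  obtain ⟨i, hi⟩ := h
  have hj : ∀ j, u j ≠ v j ↔ j = i := fun j => by
    simpa using Finset.ext_iff.1 hi j
  refine ⟨i, funext fun j => ?_⟩
  by_cases h : j = i
  · subst h
    rw [flip_apply_self]
    have := (hj j).2 rfl
    revert this
    cases u j <;> cases v j <;> simp
  · rw [flip_apply_of_ne _ h]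
    exact (not_not.1 (mt (hj j).1 h)).symm

/-- The number of coordinates equal to `true`. -/
def weight {n : ℕ} (u : Fin n → Bool) : ℕ := (univ.filter fun i => u i = true).card

theorem weight_flip {n : ℕ} {u : Fin n → Bool} {i : Fin n} (h : u i = true) :
    weight (flip u i) + 1 = weight u := by
  have h1 : (univ.filter fun j => flip u i j = true) = (univ.filter fun j => u j = true).erase i := by
    ext j
    simp only [mem_filter, mem_univ, true_and, mem_erase]
    by_cases hj : j = i
    · subst hj; simp [flip_apply_self, h]
    · simp [flip_apply_of_ne _ hj, hj]
  rw [weight, h1, card_erase_add_one (by simp [h]), weight]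

theorem weight_cons {n : ℕ} (b : Bool) (x : Fin n → Bool) :
    weight (Fin.cons b x : Fin (n + 1) → Bool) = b.toNat + weight x := by
  rw [weight, Fin.card_filter_univ_succ, weight]
  cases b <;> simp [add_comm]

/-- The parity of the number of coordinates equal to `true`. -/
def par {n : ℕ} (u : Fin n → Bool) : Bool := decide (weight u % 2 = 1)

theorem par_flip {n : ℕ} (u : Fin n → Bool) (i : Fin n) : par (flip u i) = !par u := by
  have key : ∀ a b : ℕ, (a + 1 = b ∨ b + 1 = a) → decide (a % 2 = 1) = !decide (b % 2 = 1) := by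
    intro a b hab
    rw [← decide_not, decide_eq_decide]
    omega
  refine key _ _ ?_
  cases h : u i
  · right
    have := weight_flip (u := flip u i) (i := i) (by rw [flip_apply_self, h]; rfl)
    rwa [flip_flip] at this
  · exact Or.inl (weight_flip h)

theorem flip_cons_zero {n : ℕ} (b : Bool) (x : Fin n → Bool) :
    flip (Fin.cons b x : Fin (n + 1) → Bool) 0 = Fin.cons (!b) x := by
  rw [flip, Fin.cons_zero, Fin.update_cons_zero]

theorem flip_cons_succ {n : ℕ} (b : Bool) (x : Fin n → Bool) (i : Fin n) :
    flip (Fin.cons b x : Fin (n + 1) → Bool) i.succ = Fin.cons b (flip x i) := by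
  rw [flip, flip, Fin.cons_succ, Fin.cons_update]

theorem parity_bound {d : ℕ} {f : (Fin d → Bool) → ℤ} (hf : f ∈ HomF d) :
    ∀ (k : ℕ) (u : Fin d → Bool), weight u = k → (f u - k) % 2 = 0 ∧ |f u| ≤ k := by
  intro k
  induction k with
  | zero =>
    intro u hu
    have : u = fun _ => false := by
      rw [weight, card_eq_zero, filter_eq_empty_iff] at hu
      exact funext fun i => by simpa using hu (mem_univ i)
    rw [this, hf.1]
    simp
  | succ k ih =>
    intro u hu
    have hne : (univ.filter fun i => u i = true).Nonempty := by
      rw [← card_pos, ← weight, hu]; omega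
    obtain ⟨i, hi⟩ := hne
    have hw := weight_flip (mem_filter.1 hi).2
    obtain ⟨h1, h2⟩ := ih (flip u i) (by omega)
    have h3 := hf.2 _ _ (cubeAdj_flip u i)
    rw [abs_eq (by norm_num)] at h3
    rw [abs_le] at h2 ⊢
    push_cast
    omega

/-- The restrictions of a function on the cube to the even and the odd vertices, both indexed by
the last coordinates. -/
def split {n : ℕ} (f : (Fin (n + 1) → Bool) → ℤ) :
    ((Fin n → Bool) → ℤ) × ((Fin n → Bool) → ℤ) :=
  (fun x => f (Fin.cons (par x) x), fun x => f (Fin.cons (!par x) x))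

theorem range_split {n : ℕ} (f : (Fin (n + 1) → Bool) → ℤ) :
    Set.range f = Set.range (split f).1 ∪ Set.range (split f).2 := by
  ext a
  constructor
  · rintro ⟨u, rfl⟩
    rw [← Fin.cons_self_tail u]
    by_cases h : u 0 = par (Fin.tail u)
    · exact Or.inl ⟨Fin.tail u, by simp [split, h]⟩
    · refine Or.inr ⟨Fin.tail u, ?_⟩
      replace h := Bool.eq_not.2 h
      simp [split, h]
  · rintro (⟨x, rfl⟩ | ⟨x, rfl⟩) <;> exact ⟨_, rfl⟩

theorem split_injective {n : ℕ} : Function.Injective (split (n := n)) := by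
  intro f f' h
  simp only [split, Prod.mk.injEq, funext_iff] at h
  funext u
  rw [← Fin.cons_self_tail u]
  by_cases hu : u 0 = par (Fin.tail u)
  · rw [hu]; exact h.1 _
  · rw [Bool.eq_not.2 hu]; exact h.2 _

theorem normal_split {n : ℕ} {f : (Fin (n + 1) → Bool) → ℤ} (hf : f ∈ HomF (n + 1)) :
    Normal ball (fun _ => false) (n + 1) (split f) where
  pair := by
    have hp : ∀ x : Fin n → Bool, (par x).toNat = weight x % 2 := by
      intro x
      unfold par
      by_cases h : weight x % 2 = 1
      · simp [h]
      · simp [h]; omega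
    have hn : ∀ b : Bool, (!b).toNat + b.toNat = 1 := by decide
    refine ⟨fun x => ?_, fun x => ?_, fun x y hy => ?_⟩
    · have h1 := (parity_bound hf _ _ (weight_cons (par x) x)).1
      rw [hp] at h1
      push_cast at h1
      rw [Int.even_iff, split]
      simp only
      omega
    · have h1 := (parity_bound hf _ _ (weight_cons (!par x) x)).1
      have h2 := hn (par x)
      rw [hp] at h2
      push_cast at h1
      rw [Int.odd_iff, split]
      simp only
      omega
    · rcases mem_ball.1 hy with rfl | ⟨i, rfl⟩
      · have := cubeAdj_flip (Fin.cons (par y) y : Fin (n + 1) → Bool) 0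
        rw [flip_cons_zero] at this
        exact hf.2 _ _ this
      · have := cubeAdj_flip (Fin.cons (par x) x : Fin (n + 1) → Bool) i.succ
        rw [flip_cons_succ] at this
        simp only [split, par_flip, Bool.not_not]
        exact hf.2 _ _ this
  base := by
    have h1 : par (fun _ : Fin n => false) = false := by simp [par, weight]
    have h2 : (Fin.cons false (fun _ => false) : Fin (n + 1) → Bool) = fun _ => false := by
      funext i
      refine Fin.cases ?_ (fun j => ?_) i <;> simp
    simp only [split, h1, h2]
    exact hf.1
  bound := by
    have key : ∀ u, |f u| ≤ (n + 1 : ℕ) := by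
      intro u
      refine (parity_bound hf _ u rfl).2.trans ?_
      have : weight u ≤ n + 1 := (card_le_univ _).trans (by simp)
      exact_mod_cast this
    exact fun x => ⟨key _, key _⟩

theorem exists_split_eq {n M : ℕ} {p : ((Fin n → Bool) → ℤ) × ((Fin n → Bool) → ℤ)}
    (hp : Normal ball (fun _ => false) M p) : ∃ f ∈ HomF (n + 1), split f = p := by
  let f : (Fin (n + 1) → Bool) → ℤ := fun u =>
    if u 0 = par (Fin.tail u) then p.1 (Fin.tail u) else p.2 (Fin.tail u)
  have hf : ∀ b x, f (Fin.cons b x) = if b = par x then p.1 x else p.2 x := by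
    intro b x; simp [f]
  refine ⟨f, ⟨?_, fun u v huv => ?_⟩, ?_⟩
  · have h1 : par (fun _ : Fin n => false) = false := by simp [par, weight]
    have h2 : (Fin.cons false (fun _ => false) : Fin (n + 1) → Bool) = fun _ => false := by
      funext i
      refine Fin.cases ?_ (fun j => ?_) i <;> simp
    rw [← h2, hf, h1, if_pos rfl]
    exact hp.base
  · obtain ⟨i, rfl⟩ := exists_eq_flip huv
    rw [← Fin.cons_self_tail u]
    generalize u 0 = b
    generalize Fin.tail u = x
    have key : ∀ y z, z ∈ ball y → ∀ q : Bool,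
        |(if q then p.1 y else p.2 y) - (if q then p.2 z else p.1 z)| = 1 := by
      intro y z hz q
      cases q
      · simpa [abs_sub_comm] using hp.pair.adj z y ((isReg_ball n).symm _ _ hz)
      · simpa using hp.pair.adj y z hz
    refine Fin.cases ?_ (fun j => ?_) i
    · rw [flip_cons_zero, hf, hf]
      have := key x x ((isReg_ball n).refl x) (decide (b = par x))
      cases b <;> cases h : par x <;> simpa [h] using this
    · rw [flip_cons_succ, hf, hf, par_flip]
      have := key x _ (mem_ball.2 (Or.inr ⟨j, rfl⟩)) (decide (b = par x))
      cases b <;> cases h : par x <;> simpa [h] using this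
  · refine Prod.ext (funext fun x => ?_) (funext fun x => ?_)
    · simp [split, hf]
    · simp [split, hf]

/-- The normalised height functions on the cube, as a finite set. -/
noncomputable def normals (n : ℕ) : Finset (((Fin n → Bool) → ℤ) × ((Fin n → Bool) → ℤ)) :=
  (Icc (fun _ => -(n + 1 : ℤ), fun _ => -(n + 1 : ℤ)) (fun _ => (n + 1 : ℤ), fun _ => (n + 1 : ℤ))).filter
    (Normal ball (fun _ => false) (n + 1))

theorem mem_normals {n : ℕ} {p : ((Fin n → Bool) → ℤ) × ((Fin n → Bool) → ℤ)} :
    p ∈ normals n ↔ Normal ball (fun _ => false) (n + 1) p := by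
  rw [normals, mem_filter, and_iff_right_iff_imp]
  intro hp
  have h1 := fun x => abs_le.1 (hp.bound x).1
  have h2 := fun x => abs_le.1 (hp.bound x).2
  push_cast at h1 h2
  rw [mem_Icc]
  exact ⟨⟨fun x => (h1 x).1, fun x => (h2 x).1⟩, ⟨fun x => (h1 x).2, fun x => (h2 x).2⟩⟩

theorem ncard_homF (n : ℕ) (Q : Set ℤ → Prop) :
    {f ∈ HomF (n + 1) | Q (Set.range f)}.ncard =
      ((normals n).filter fun p => Q (Set.range p.1 ∪ Set.range p.2)).card := by
  rw [← Set.ncard_image_of_injective _ (split_injective (n := n)), ← Set.ncard_coe_finset]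
  congr 1
  ext p
  simp only [Set.mem_image, Set.mem_ofPred_eq, mem_coe, mem_filter, mem_normals]
  constructor
  · rintro ⟨f, ⟨hf, hQ⟩, rfl⟩
    exact ⟨normal_split hf, by rwa [← range_split]⟩
  · rintro ⟨hp, hQ⟩
    obtain ⟨f, hf, rfl⟩ := exists_split_eq hp
    exact ⟨f, ⟨hf, by rwa [range_split]⟩, rfl⟩

theorem exists_three_le_of_five_lt {V : Type*} {p : (V → ℤ) × (V → ℤ)}
    (hp : 5 < (Set.range p.1 ∪ Set.range p.2).ncard) (k : ℤ) :
    ∃ x, 3 ≤ |p.1 x - k| ∨ 3 ≤ |p.2 x - k| := by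
  by_contra! h
  have hsub : Set.range p.1 ∪ Set.range p.2 ⊆ (Icc (k - 2) (k + 2) : Finset ℤ) := by
    rintro a (⟨x, rfl⟩ | ⟨x, rfl⟩)
    · have := abs_lt.1 (h x).1
      rw [mem_coe, mem_Icc]; omega
    · have := abs_lt.1 (h x).2
      rw [mem_coe, mem_Icc]; omega
  have h1 := Set.ncard_le_ncard hsub (finite_toSet _)
  rw [Set.ncard_coe_finset, Int.card_Icc] at h1
  omega

theorem Normal.ncard_range_eq_five {V : Type*} {nb : V → Finset V} {v : V}
    {p : (V → ℤ) × (V → ℤ)} (hrefl : ∀ x, x ∈ nb x) (hp : Normal nb v 2 p) (h1 : ∃ x, p.1 x = 2)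
    (h2 : ∃ x, p.1 x = -2) : (Set.range p.1 ∪ Set.range p.2).ncard = 5 := by
  have h : Set.range p.1 ∪ Set.range p.2 = (Icc (-2) 2 : Finset ℤ) := by
    ext a
    rw [mem_coe, mem_Icc]
    constructor
    · rintro (⟨x, rfl⟩ | ⟨x, rfl⟩)
      · exact abs_le.1 (hp.bound x).1
      · exact abs_le.1 (hp.bound x).2
    · intro ha
      obtain ⟨x, hx⟩ := h1
      obtain ⟨y, hy⟩ := h2
      have ex := hp.pair.adj x x (hrefl x)
      have ey := hp.pair.adj y y (hrefl y)
      have bx := abs_le.1 (hp.bound x).2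
      have bdy := abs_le.1 (hp.bound y).2
      rw [abs_eq (by norm_num)] at ex ey
      have hcases : a = 2 ∨ a = -2 ∨ a = 0 ∨ a = 1 ∨ a = -1 := by omega
      push_cast at bx bdy
      rcases hcases with rfl | rfl | rfl | rfl | rfl
      · exact Or.inl ⟨x, hx⟩
      · exact Or.inl ⟨y, hy⟩
      · exact Or.inl ⟨v, hp.base⟩
      · exact Or.inr ⟨x, by omega⟩
      · exact Or.inr ⟨y, by omega⟩
  rw [h, Set.ncard_coe_finset]
  rfl

end CubeHom

theorem range_at_most_five :
    ∃ c > (0:ℝ), ∃ c' > (0:ℝ), ∃ d₀ : ℕ, ∀ d : ℕ, d₀ ≤ d →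
      (({f ∈ HomF d | 5 < (Set.range f).ncard} : Set _).ncard : ℝ) ≤
          Real.exp (-c * d) * (HomF d).ncard ∧
      c' * ((HomF d).ncard : ℝ) ≤
          (({f ∈ HomF d | (Set.range f).ncard = 5} : Set _).ncard : ℝ) := by
  obtain ⟨d₀, hd₀⟩ := CubeHom.exists_scaleFor
  refine ⟨Real.log 2, Real.log_pos (by norm_num), 1 / 1600, by norm_num, d₀ + 1, fun d hd => ?_⟩
  obtain ⟨n, rfl⟩ : ∃ n, d = n + 1 := ⟨d - 1, by omega⟩
  obtain ⟨l, hl⟩ := hd₀ (n + 1) (by omega)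
  have h := CubeHom.expanding_ball hl
  have hall : (HomF (n + 1)).ncard = (CubeHom.normals n).card := by
    have := CubeHom.ncard_homF n (fun _ => True)
    simpa using this
  have hdeg := hl.le_degree
  have hfive := h.card_five_ge (v := fun _ => false)
    ((CubeHom.normals n).filter fun p => (Set.range p.1 ∪ Set.range p.2).ncard = 5) (by
      intro p hp h1 h2
      refine Finset.mem_filter.2 ⟨CubeHom.mem_normals.2 ⟨hp.pair, hp.base, fun x => ?_⟩,
        hp.ncard_range_eq_five (CubeHom.isReg_ball n).refl h1 h2⟩
      have hb := hp.bound x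
      push_cast at hb ⊢
      have : (2 : ℤ) ≤ n + 1 := by omega
      exact ⟨hb.1.trans this, hb.2.trans this⟩)
  have hsteep := h.card_steep_le (v := fun _ => false)
    ((CubeHom.normals n).filter fun p => 5 < (Set.range p.1 ∪ Set.range p.2).ncard) (by
      intro p hp
      obtain ⟨h1, h2⟩ := Finset.mem_filter.1 hp
      exact ⟨CubeHom.mem_normals.1 h1, CubeHom.exists_three_le_of_five_lt h2⟩)
  have htotal := h.card_normal_le (v := fun _ => false) (CubeHom.normals n)
    fun p hp => CubeHom.mem_normals.1 hp
  have hle : (((CubeHom.normals n).filter fun p =>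
      (Set.range p.1 ∪ Set.range p.2).ncard = 5).card : ℝ) ≤ (CubeHom.normals n).card := by
    exact_mod_cast Finset.card_filter_le _ _
  have e5 := CubeHom.ncard_homF n (fun s => s.ncard = 5)
  have e6 := CubeHom.ncard_homF n (fun s => 5 < s.ncard)
  have hexp : Real.exp (-Real.log 2 * (n + 1 : ℕ)) = 1 / 2 ^ (n + 1) := by
    rw [neg_mul, Real.exp_neg, mul_comm, Real.exp_nat_mul, Real.exp_log (by norm_num), one_div]
  rw [hexp, hall]
  constructor
  · rw [e6]
    refine le_trans ?_ (hsteep.trans (le_trans (le_of_eq ?_)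
      (mul_le_mul_of_nonneg_left (hfive.trans hle) (by positivity))))
    · exact le_of_eq (by congr!)
    · field_simp
  · rw [e5]
    refine le_trans ?_ (hfive.trans (le_of_eq (by congr!)))
    linarith
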